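/- arXiv:0904.3132 — 3 statements merged into one kernel-verified Lean document; each statement's English description precedes it below -/
import Mathlib

section
/- Tail bound for the posterior numerator: suppose ‖Δ_n‖² < C_1·d, λ_n(c) < 1/16, and c > 16·max{4C_1, 1/(1 − 2λ_n(c))}. Then for every k ≥ 1, ∫_{{u : ‖u‖ ≥ k√(cd)}} π(θ_0 + n^{-1/2}J^{-1}u)·Z_n(u) du ≤ (sup_θ π(θ)) · e^{c·d·λ_n(c)} · (∫_{ℝ^d} Z̃_n(u) du) · e^{−k·c·d/8}. -/
open MeasureTheory ProbabilityTheory Filter Real Set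
open scoped ENNReal RealInnerProductSpace BigOperators Topology

noncomputable section

/-- Euclidean space of dimension `d`. -/
abbrev EucSp (d : ℕ) := EuclideanSpace ℝ (Fin d)

/-- The log-normalizer `ψ(θ) = log ∫ e^{⟨x,θ⟩} dν(x)` of the exponential family. -/
def psiFun {d : ℕ} (ν : Measure (EucSp d)) (θ : EucSp d) : ℝ :=
  Real.log (∫ x, Real.exp ⟪x, θ⟫ ∂ν)

/-- The exponential-family distribution with density `f(x;θ) = exp(⟨x,θ⟩ − ψ(θ))` w.r.t. `ν`. -/
def expMeas {d : ℕ} (ν : Measure (EucSp d)) (θ : EucSp d) : Measure (EucSp d) :=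
  ν.withDensity fun x => ENNReal.ofReal (Real.exp (⟪x, θ⟫ - psiFun ν θ))

/-- The mean `E_θ[U]` of the exponential-family distribution. -/
def meanVec {d : ℕ} (ν : Measure (EucSp d)) (θ : EucSp d) : EucSp d :=
  ∫ x, x ∂(expMeas ν θ)

/-- `B_{1n}(c)`: supremum of third absolute moments of `⟨a, V⟩`, `V = J⁻¹(U − E_θ U)`. -/
def B1 {d : ℕ} (ν : Measure (EucSp d)) (Θ : Set (EucSp d)) (θ₀ : EucSp d)
    (J Jinv : EucSp d →L[ℝ] EucSp d) (n : ℕ) (c : ℝ) : ℝ :=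
  sSup {b | ∃ a θ, ‖a‖ = 1 ∧ θ ∈ Θ ∧ ‖J (θ - θ₀)‖ ^ 2 ≤ c * d / n ∧
    b = ∫ x, |⟪a, Jinv (x - meanVec ν θ)⟫| ^ 3 ∂(expMeas ν θ)}

/-- `B_{2n}(c)`: supremum of fourth moments of `⟨a, V⟩`, `V = J⁻¹(U − E_θ U)`. -/
def B2 {d : ℕ} (ν : Measure (EucSp d)) (Θ : Set (EucSp d)) (θ₀ : EucSp d)
    (J Jinv : EucSp d →L[ℝ] EucSp d) (n : ℕ) (c : ℝ) : ℝ :=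
  sSup {b | ∃ a θ, ‖a‖ = 1 ∧ θ ∈ Θ ∧ ‖J (θ - θ₀)‖ ^ 2 ≤ c * d / n ∧
    b = ∫ x, ⟪a, Jinv (x - meanVec ν θ)⟫ ^ 4 ∂(expMeas ν θ)}

/-- `λ_n(c) = (1/6)(√(cd/n)·B_{1n}(0) + (cd/n)·B_{2n}(c))`. -/
def lamN {d : ℕ} (ν : Measure (EucSp d)) (Θ : Set (EucSp d)) (θ₀ : EucSp d)
    (J Jinv : EucSp d →L[ℝ] EucSp d) (n : ℕ) (c : ℝ) : ℝ :=
  (1 / 6) * (Real.sqrt (c * d / n) * B1 ν Θ θ₀ J Jinv n 0 +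
    (c * d / n) * B2 ν Θ θ₀ J Jinv n c)

open scoped Classical in
/-- `Z_n(u)`, the likelihood ratio in the local parameter, as a function of the
data total `s = Σᵢ Xᵢ`; equal to `0` when `θ₀ + n^{-1/2}J⁻¹u ∉ Θ`. -/
def Zfun {d : ℕ} (ν : Measure (EucSp d)) (Θ : Set (EucSp d)) (θ₀ : EucSp d)
    (Jinv : EucSp d →L[ℝ] EucSp d) (n : ℕ) (s u : EucSp d) : ℝ :=
  if θ₀ + (Real.sqrt n)⁻¹ • Jinv u ∈ Θ then
    Real.exp ((Real.sqrt n)⁻¹ * ⟪s, Jinv u⟫ -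
      n * (psiFun ν (θ₀ + (Real.sqrt n)⁻¹ • Jinv u) - psiFun ν θ₀))
  else 0

/-- `Z̃_n(u) = exp(⟨u, Δ⟩ − ‖u‖²/2)`. -/
def Ztil {d : ℕ} (Δ u : EucSp d) : ℝ := Real.exp (⟪u, Δ⟫ - ‖u‖ ^ 2 / 2)

/-- `Δ_n = √n·J⁻¹(X̄_n − μ)`, as a function of the data total `s = Σᵢ Xᵢ`. -/
def DeltaN {d : ℕ} (Jinv : EucSp d →L[ℝ] EucSp d) (μ : EucSp d) (n : ℕ) (s : EucSp d) :
    EucSp d :=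
  Real.sqrt n • Jinv ((n : ℝ)⁻¹ • s - μ)

/-- The standard `d`-variate normal density with mean `m` and identity covariance. -/
def gaussD {d : ℕ} (m u : EucSp d) : ℝ :=
  (2 * Real.pi) ^ (-(d : ℝ) / 2) * Real.exp (-‖u - m‖ ^ 2 / 2)

/-- The posterior density `π_n^*(u)` of the local parameter `u = √n·J(θ − θ₀)`,
as a function of the data total `s = Σᵢ Xᵢ`. -/
def postStar {d : ℕ} (ν : Measure (EucSp d)) (Θ : Set (EucSp d)) (θ₀ : EucSp d)
    (Jinv : EucSp d →L[ℝ] EucSp d) (n : ℕ) (prior : EucSp d → ℝ) (s u : EucSp d) : ℝ :=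
  prior (θ₀ + (Real.sqrt n)⁻¹ • Jinv u) * Zfun ν Θ θ₀ Jinv n s u /
    ∫ v, prior (θ₀ + (Real.sqrt n)⁻¹ • Jinv v) * Zfun ν Θ θ₀ Jinv n s v

theorem cubic_taylor_le_exp (x : ℝ) : 1 + x + x ^ 2 / 2 + x ^ 3 / 6 ≤ exp x := by
  rcases le_total 0 x with hx | hx
  · have h := Real.sum_le_exp_of_nonneg hx 4
    simp only [Finset.sum_range_succ, Finset.sum_range_zero, Nat.factorial] at h
    norm_num at h
    linarith
  · have hd : ∀ y : ℝ, HasDerivAt (fun y => (1 + y + y ^ 2 / 2 + y ^ 3 / 6) * exp (-y))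
        (-(y ^ 3 / 6) * exp (-y)) y := by
      intro y
      have h1 : HasDerivAt (fun y : ℝ => 1 + y + y ^ 2 / 2 + y ^ 3 / 6) (1 + y + y ^ 2 / 2) y := by
        convert! (((hasDerivAt_id y).const_add 1).add ((hasDerivAt_pow 2 y).div_const 2)).add
          ((hasDerivAt_pow 3 y).div_const 6) using 1
        norm_num
        ring
      convert! h1.mul (hasDerivAt_neg y).exp using 1
      ring
    have hmono : MonotoneOn (fun y : ℝ => (1 + y + y ^ 2 / 2 + y ^ 3 / 6) * exp (-y)) (Iic 0) := by
      refine monotoneOn_of_deriv_nonneg (convex_Iic 0)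
        (fun y _ => (hd y).continuousAt.continuousWithinAt)
        (fun y _ => (hd y).differentiableAt.differentiableWithinAt) fun y hy => ?_
      rw [interior_Iic] at hy
      rw [(hd y).deriv]
      have : y ^ 3 ≤ 0 := by
        have := pow_nonneg (neg_nonneg.2 (le_of_lt (mem_Iio.1 hy))) 3
        nlinarith
      exact mul_nonneg (by linarith) (exp_pos _).le
    have h := hmono (mem_Iic.2 hx) (mem_Iic.2 le_rfl) hx
    norm_num [Real.exp_neg] at h
    rwa [← div_eq_mul_inv, div_le_one (exp_pos x)] at h

/-- Lower bound for the cumulant generating function of a centred variable whose third absolute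
moment is small compared with its variance. -/
theorem mul_variance_le_log_integral_exp {Ω : Type*} [MeasurableSpace Ω] {P : Measure Ω}
    [IsProbabilityMeasure P] {Y : Ω → ℝ} {v : ℝ}
    (h1 : Integrable Y P) (h2 : Integrable (fun x => Y x ^ 2) P)
    (h3 : Integrable (fun x => |Y x| ^ 3) P) (he : Integrable (fun x => exp (Y x)) P)
    (hm : ∫ x, Y x ∂P = 0) (hv : ∫ x, Y x ^ 2 ∂P = v)
    (h3v : ∫ x, |Y x| ^ 3 ∂P ≤ 3 / 8 * v) (hv' : v ≤ 9 / 64) :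
    41 / 100 * v ≤ log (∫ x, exp (Y x) ∂P) := by
  have hv0 : 0 ≤ v := hv ▸ integral_nonneg fun x => sq_nonneg (Y x)
  have hexp : 1 + 7 / 16 * v ≤ ∫ x, exp (Y x) ∂P := by
    have i1 : Integrable (fun x => 1 + Y x) P := (integrable_const _).add h1
    have i2 : Integrable (fun x => 1 + Y x + Y x ^ 2 / 2) P := i1.add (h2.div_const 2)
    have hle : ∫ x, (1 + Y x + Y x ^ 2 / 2 - |Y x| ^ 3 / 6) ∂P ≤ ∫ x, exp (Y x) ∂P := by
      refine integral_mono (i2.sub (h3.div_const 6)) he fun x => ?_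
      have ha : -|Y x| ^ 3 ≤ Y x ^ 3 := by
        rw [← abs_pow]
        exact neg_abs_le _
      have := cubic_taylor_le_exp (Y x)
      simp only
      linarith
    rw [integral_sub i2 (h3.div_const 6), integral_add i1 (h2.div_const 2),
      integral_add (integrable_const _) h1, integral_div, integral_div, hm, hv] at hle
    simp only [integral_const, probReal_univ, smul_eq_mul] at hle
    linarith
  have hpos : 0 < 1 + 7 / 16 * v := by linarith
  calc 41 / 100 * v ≤ 1 - (1 + 7 / 16 * v)⁻¹ := by
        rw [le_sub_iff_add_le, ← le_sub_iff_add_le', inv_le_iff_one_le_mul₀ hpos]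
        nlinarith
    _ ≤ log (1 + 7 / 16 * v) := Real.one_sub_inv_le_log_of_pos hpos
    _ ≤ _ := log_le_log hpos hexp

/-- Convexity of `t ↦ log E[exp (t Y)]` between `0` and `p`. -/
theorem mul_log_integral_exp_le {Ω : Type*} [MeasurableSpace Ω] {P : Measure Ω}
    [IsProbabilityMeasure P] {Y : Ω → ℝ} {p : ℝ} (hp : 1 ≤ p)
    (h1 : Integrable (fun x => exp (Y x)) P) (h2 : Integrable (fun x => exp (p * Y x)) P) :
    p * log (∫ x, exp (Y x) ∂P) ≤ log (∫ x, exp (p * Y x) ∂P) := by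
  set m := ∫ x, exp (Y x) ∂P with hm
  have hm0 : 0 < m := integral_exp_pos h1
  have key : m ^ p ≤ ∫ x, exp (p * Y x) ∂P := by
    have i1 : Integrable (fun x => exp (Y x) / m - 1) P :=
      (h1.div_const m).sub (integrable_const _)
    have hle : ∫ x, m ^ p * (1 + p * (exp (Y x) / m - 1)) ∂P ≤ ∫ x, exp (p * Y x) ∂P := by
      refine integral_mono (((integrable_const _).add (i1.const_mul p)).const_mul _) h2 fun x => ?_
      have h := one_add_mul_self_le_rpow_one_add (s := exp (Y x) / m - 1)
        (by have := div_pos (exp_pos (Y x)) hm0; linarith) hp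
      rw [add_sub_cancel, div_rpow (exp_pos _).le hm0.le, ← Real.exp_mul] at h
      have hmp : 0 < m ^ p := rpow_pos_of_pos hm0 p
      calc m ^ p * (1 + p * (exp (Y x) / m - 1)) ≤ m ^ p * (exp (Y x * p) / m ^ p) :=
            mul_le_mul_of_nonneg_left h hmp.le
        _ = exp (p * Y x) := by rw [mul_div_cancel₀ _ hmp.ne', mul_comm p]
    rw [integral_const_mul, integral_add (integrable_const _) (i1.const_mul p), integral_const_mul,
      integral_sub (h1.div_const m) (integrable_const _), integral_div, ← hm,
      div_self hm0.ne'] at hle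
    simpa using hle
  calc p * log m = log (m ^ p) := (log_rpow hm0 p).symm
    _ ≤ _ := log_le_log (rpow_pos_of_pos hm0 p) key

theorem integrable_exp_neg_abs_div_four : Integrable fun x : ℝ => exp (-|x| / 4) := by
  have h : IntegrableOn (fun x : ℝ => exp (-|x| / 4)) (Ioi 0) := by
    refine (integrableOn_exp_mul_Ioi (a := -(1 / 4)) (by norm_num) 0).congr_fun (fun x hx => ?_)
      measurableSet_Ioi
    simp only [abs_of_pos (mem_Ioi.1 hx)]
    ring_nf
  have h' : IntegrableOn (fun x : ℝ => exp (-|x| / 4)) (Iic 0) := by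
    refine (integrableOn_exp_mul_Iic (a := 1 / 4) (by norm_num) 0).congr_fun (fun x hx => ?_)
      measurableSet_Iic
    simp only [abs_of_nonpos (mem_Iic.1 hx)]
    ring_nf
  simpa using h'.union h

theorem integral_exp_neg_abs_div_four : ∫ x : ℝ, exp (-|x| / 4) = 8 := by
  rw [integral_comp_abs (f := fun x => exp (-x / 4))]
  have := integral_exp_mul_Ioi (a := -(1 / 4)) (by norm_num) 0
  rw [setIntegral_congr_fun measurableSet_Ioi
    (g := fun x : ℝ => exp (-(1 / 4) * x)) fun x _ => by ring_nf, this]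
  norm_num

theorem exp_neg_sum_abs_eq_prod {d : ℕ} (u : Fin d → ℝ) :
    exp (-(∑ i, |u i|) / 4) = ∏ i, exp (-|u i| / 4) := by
  rw [← Real.exp_sum, ← Finset.sum_div, Finset.sum_neg_distrib]

theorem integrable_exp_neg_sum_abs (d : ℕ) :
    Integrable fun u : EucSp d => exp (-(∑ i, |u i|) / 4) := by
  rw [← (PiLp.volume_preserving_toLp (Fin d)).integrable_comp_emb
    (MeasurableEquiv.toLp 2 _).measurableEmbedding]
  simp only [Function.comp_def, exp_neg_sum_abs_eq_prod]
  exact Integrable.fintype_prod (f := fun _ x => exp (-|x| / 4))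
    fun _ => integrable_exp_neg_abs_div_four

theorem integral_exp_neg_sum_abs (d : ℕ) :
    ∫ u : EucSp d, exp (-(∑ i, |u i|) / 4) = 8 ^ d := by
  rw [← (PiLp.volume_preserving_toLp (Fin d)).integral_comp
    (MeasurableEquiv.toLp 2 _).measurableEmbedding]
  simp only [exp_neg_sum_abs_eq_prod]
  rw [integral_fintype_prod_volume_eq_pow (fun x : ℝ => exp (-|x| / 4)),
    integral_exp_neg_abs_div_four, Fintype.card_fin]

theorem Ztil_eq_mul {d : ℕ} (Δ u : EucSp d) :
    Ztil Δ u = exp (‖Δ‖ ^ 2 / 2) * exp (-‖u - Δ‖ ^ 2 / 2) := by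
  rw [Ztil, ← Real.exp_add, norm_sub_sq_real]
  ring_nf

theorem two_pow_le_integral_Ztil {d : ℕ} (Δ : EucSp d) : 2 ^ d ≤ ∫ u, Ztil Δ u := by
  simp only [Ztil_eq_mul]
  rw [integral_const_mul, integral_sub_right_eq_self (fun u : EucSp d => exp (-‖u‖ ^ 2 / 2))]
  have h := GaussianFourier.integral_rexp_neg_mul_sq_norm (V := EucSp d) (b := 1 / 2) (by norm_num)
  have h' : ∫ u : EucSp d, exp (-‖u‖ ^ 2 / 2) = (2 * π) ^ ((d : ℝ) / 2) := by
    calc _ = ∫ u : EucSp d, exp (-(1 / 2) * ‖u‖ ^ 2) := by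
          congr 1; ext u; ring_nf
      _ = _ := by
        rw [h, finrank_euclideanSpace_fin]
        congr 1
        ring
  rw [h']
  have hpi := Real.pi_gt_three
  have h4 : (2 : ℝ) ^ d ≤ (2 * π) ^ ((d : ℝ) / 2) := by
    calc (2 : ℝ) ^ d = (4 : ℝ) ^ ((d : ℝ) / 2) := by
          rw [show (4 : ℝ) = 2 ^ (2 : ℝ) by norm_num, ← rpow_mul (by norm_num),
            mul_div_cancel₀ _ two_ne_zero, rpow_natCast]
      _ ≤ _ := rpow_le_rpow (by norm_num) (by linarith) (by positivity)
  have h1 : 1 ≤ exp (‖Δ‖ ^ 2 / 2) := Real.one_le_exp (by positivity)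
  nlinarith [pow_pos (two_pos (α := ℝ)) d]

theorem norm_le_sum_abs {d : ℕ} (x : EucSp d) : ‖x‖ ≤ ∑ i, |x i| := by
  rw [EuclideanSpace.norm_eq, Real.sqrt_le_left (Finset.sum_nonneg fun i _ => abs_nonneg _)]
  simp only [Real.norm_eq_abs]
  exact Finset.sum_sq_le_sq_sum_of_nonneg fun i _ => abs_nonneg _

theorem sum_abs_le_sqrt_mul_norm {d : ℕ} (x : EucSp d) : ∑ i, |x i| ≤ √d * ‖x‖ := by
  rw [EuclideanSpace.norm_eq, ← Real.sqrt_mul (Nat.cast_nonneg d)]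
  refine Real.le_sqrt_of_sq_le ?_
  simpa using sq_sum_le_card_mul_sum_sq (s := Finset.univ) (f := fun i => |x i|)

theorem exp_mul_norm_le {d : ℕ} {t : ℝ} (ht : 0 < t) (x : EucSp d) :
    exp (t / (d + 1) * ‖x‖) ≤ 1 + ∑ i, (exp (t * x i) + exp (-t * x i)) := by
  have hd : (0 : ℝ) < d + 1 := by positivity
  have hsum : 0 ≤ ∑ i, (exp (t * x i) + exp (-t * x i)) :=
    Finset.sum_nonneg fun i _ => by positivity
  rcases isEmpty_or_nonempty (Fin d) with h | h
  · have : x = 0 := Subsingleton.elim _ _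
    simp [this]
  · have h' : ∑ _i : Fin d, ‖x‖ / (d + 1) ≤ ∑ i, |x i| := by
      refine le_trans ?_ (norm_le_sum_abs x)
      simp only [Finset.sum_const, Finset.card_univ, Fintype.card_fin, nsmul_eq_mul]
      rw [mul_div_assoc', div_le_iff₀ hd]
      nlinarith [norm_nonneg x]
    obtain ⟨i, -, hi⟩ := Finset.exists_le_of_sum_le Finset.univ_nonempty h'
    have hle : exp (t / (d + 1) * ‖x‖) ≤ exp (t * x i) + exp (-t * x i) := by
      calc exp (t / (d + 1) * ‖x‖) ≤ exp (t * |x i|) := by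
            rw [Real.exp_le_exp, div_mul_eq_mul_div, ← mul_div_assoc']
            exact mul_le_mul_of_nonneg_left hi ht.le
        _ ≤ _ := by
            rcases abs_cases (x i) with h | h <;> rw [h.1]
            · linarith [exp_pos (-t * x i)]
            · rw [mul_neg, ← neg_mul]
              linarith [exp_pos (t * x i)]
    have := Finset.single_le_sum (f := fun i => exp (t * x i) + exp (-t * x i))
      (fun i _ => by positivity) (Finset.mem_univ i)
    simp only at this
    linarith

section ExponentialFamily

variable {d : ℕ} {ν : Measure (EucSp d)} {U : Set (EucSp d)} {θ : EucSp d}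

theorem exists_integrable_exp_inner_add_norm (hU : U ∈ 𝓝 θ)
    (hfin : ∀ ϑ ∈ U, Integrable (fun x => exp ⟪x, ϑ⟫) ν) :
    ∃ ε > 0, Integrable (fun x => exp (⟪x, θ⟫ + ε * ‖x‖)) ν := by
  obtain ⟨r, hr, hball⟩ := Metric.mem_nhds_iff.1 hU
  have hmem : ∀ (i : Fin d) (a : ℝ), |a| ≤ r / 2 →
      Integrable (fun x : EucSp d => exp ⟪x, θ⟫ * exp (a * x i)) ν := by
    intro i a ha
    have h : θ + a • EuclideanSpace.single i (1 : ℝ) ∈ U := by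
      apply hball
      rw [Metric.mem_ball, dist_self_add_left, norm_smul, PiLp.norm_single]
      simp only [Real.norm_eq_abs, abs_one, mul_one]
      linarith
    refine (hfin _ h).congr (ae_of_all _ fun x => ?_)
    simp only [← Real.exp_add]
    rw [inner_add_right, inner_smul_right, EuclideanSpace.inner_single_right]
    simp
  have h0 : Integrable (fun x => exp ⟪x, θ⟫) ν := hfin θ (mem_of_mem_nhds hU)
  have ht : 0 < r / 2 := half_pos hr
  refine ⟨r / 2 / (d + 1), by positivity, ?_⟩
  have hb : Integrable (fun x : EucSp d => exp ⟪x, θ⟫ + ∑ i, (exp ⟪x, θ⟫ * exp (r / 2 * x i) +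
      exp ⟪x, θ⟫ * exp (-(r / 2) * x i))) ν :=
    h0.add (integrable_finsetSum _ fun i _ =>
      (hmem i _ (abs_of_pos ht).le).add (hmem i _ (by rw [abs_neg, abs_of_pos ht])))
  refine hb.mono' (by fun_prop) (ae_of_all _ fun x => ?_)
  rw [Real.norm_eq_abs, abs_of_pos (exp_pos _), Real.exp_add]
  refine (mul_le_mul_of_nonneg_left (exp_mul_norm_le ht x) (exp_pos _).le).trans_eq ?_
  rw [mul_add, mul_one, Finset.mul_sum]
  simp only [mul_add]

theorem differentiableAt_psiFun (hU : U ∈ 𝓝 θ)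
    (hfin : ∀ ϑ ∈ U, Integrable (fun x => exp ⟪x, ϑ⟫) ν) (hpos : 0 < ∫ x, exp ⟪x, θ⟫ ∂ν) :
    DifferentiableAt ℝ (psiFun ν) θ := by
  obtain ⟨ε, hε, hint⟩ := exists_integrable_exp_inner_add_norm hU hfin
  refine DifferentiableAt.log (HasFDerivAt.differentiableAt
    (hasFDerivAt_integral_of_dominated_of_fderiv_le (s := Metric.ball θ (ε / 2))
    (F := fun ϑ x => exp ⟪x, ϑ⟫) (F' := fun ϑ x => exp ⟪x, ϑ⟫ • innerSL ℝ x)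
    (bound := fun x => 2 / ε * exp (⟪x, θ⟫ + ε * ‖x‖))
    (Metric.ball_mem_nhds _ (half_pos hε)) (Eventually.of_forall fun ϑ => by fun_prop)
    (hfin θ (mem_of_mem_nhds hU)) ?_ ?_ (hint.const_mul _) ?_)) hpos.ne'
  · have : Continuous fun x : EucSp d => exp ⟪x, θ⟫ • innerSL ℝ x := by fun_prop
    exact this.aestronglyMeasurable
  · refine ae_of_all _ fun x ϑ hϑ => ?_
    rw [norm_smul, innerSL_apply_norm, Real.norm_eq_abs, abs_of_pos (exp_pos _)]
    have h1 : ⟪x, ϑ⟫ ≤ ⟪x, θ⟫ + ε / 2 * ‖x‖ := by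
      have := real_inner_le_norm x (ϑ - θ)
      rw [inner_sub_right] at this
      rw [Metric.mem_ball, dist_eq_norm] at hϑ
      nlinarith [norm_nonneg x]
    have h2 : ‖x‖ ≤ 2 / ε * exp (ε / 2 * ‖x‖) := by
      have := Real.add_one_le_exp (ε / 2 * ‖x‖)
      rw [div_mul_eq_mul_div, le_div_iff₀ hε]
      linarith
    calc exp ⟪x, ϑ⟫ * ‖x‖
        ≤ exp (⟪x, θ⟫ + ε / 2 * ‖x‖) * (2 / ε * exp (ε / 2 * ‖x‖)) :=
          mul_le_mul (exp_le_exp.2 h1) h2 (norm_nonneg x) (exp_pos _).le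
      _ = 2 / ε * exp (⟪x, θ⟫ + ε * ‖x‖) := by
          rw [mul_left_comm, ← Real.exp_add]
          ring_nf
  · refine ae_of_all _ fun x ϑ _ => ?_
    exact ((innerSL ℝ x).hasFDerivAt).exp

theorem expMeas_eq_tilted (hpos : 0 < ∫ x, exp ⟪x, θ⟫ ∂ν) :
    expMeas ν θ = ν.tilted fun x => ⟪x, θ⟫ := by
  simp only [expMeas, Measure.tilted, psiFun, Real.exp_sub, Real.exp_log hpos]

theorem isProbabilityMeasure_expMeas (hint : Integrable (fun x => exp ⟪x, θ⟫) ν)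
    (hpos : 0 < ∫ x, exp ⟪x, θ⟫ ∂ν) : IsProbabilityMeasure (expMeas ν θ) := by
  have : NeZero ν := ⟨by rintro rfl; simp at hpos⟩
  rw [expMeas_eq_tilted hpos]
  exact isProbabilityMeasure_tilted hint

theorem integrable_exp_inner_expMeas {h : EucSp d} (hint : Integrable (fun x => exp ⟪x, θ⟫) ν)
    (hpos : 0 < ∫ x, exp ⟪x, θ⟫ ∂ν) (hint' : Integrable (fun x => exp ⟪x, θ + h⟫) ν) :
    Integrable (fun x => exp ⟪x, h⟫) (expMeas ν θ) := by
  rw [expMeas_eq_tilted hpos, integrable_tilted_iff hint]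
  refine hint'.congr (ae_of_all _ fun x => ?_)
  simp only [smul_eq_mul]
  rw [← Real.exp_add, inner_add_right]

theorem log_integral_exp_inner_expMeas {h : EucSp d} (hpos : 0 < ∫ x, exp ⟪x, θ⟫ ∂ν)
    (hpos' : 0 < ∫ x, exp ⟪x, θ + h⟫ ∂ν) :
    log (∫ x, exp ⟪x, h⟫ ∂(expMeas ν θ)) = psiFun ν (θ + h) - psiFun ν θ := by
  rw [expMeas_eq_tilted hpos, integral_exp_tilted]
  simp only [Pi.add_apply, ← inner_add_right]
  rw [log_div hpos'.ne' hpos.ne', psiFun, psiFun]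

theorem integrable_norm_pow_expMeas (hU : U ∈ 𝓝 θ)
    (hfin : ∀ ϑ ∈ U, Integrable (fun x => exp ⟪x, ϑ⟫) ν) (hpos : 0 < ∫ x, exp ⟪x, θ⟫ ∂ν)
    (m : ℕ) : Integrable (fun x => ‖x‖ ^ m) (expMeas ν θ) := by
  have hint := hfin θ (mem_of_mem_nhds hU)
  have := isProbabilityMeasure_expMeas hint hpos
  obtain ⟨ε, hε, hε'⟩ := exists_integrable_exp_inner_add_norm hU hfin
  have h1 : Integrable (fun x => exp (ε * ‖x‖)) (expMeas ν θ) := by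
    rw [expMeas_eq_tilted hpos, integrable_tilted_iff hint]
    refine hε'.congr (ae_of_all _ fun x => ?_)
    simp only [smul_eq_mul, Real.exp_add]
  have h2 : Integrable (fun x => exp (-ε * ‖x‖)) (expMeas ν θ) := by
    refine (integrable_const (1 : ℝ)).mono' (by fun_prop) (ae_of_all _ fun x => ?_)
    rw [Real.norm_eq_abs, abs_of_pos (exp_pos _), Real.exp_le_one_iff]
    nlinarith [norm_nonneg x]
  simpa using integrable_pow_abs_of_integrable_exp_mul hε.ne' h1 h2 m

theorem integrable_id_expMeas (hU : U ∈ 𝓝 θ)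
    (hfin : ∀ ϑ ∈ U, Integrable (fun x => exp ⟪x, ϑ⟫) ν) (hpos : 0 < ∫ x, exp ⟪x, θ⟫ ∂ν) :
    Integrable (fun x => x) (expMeas ν θ) := by
  refine (integrable_norm_iff (by fun_prop)).1 ?_
  simpa using integrable_norm_pow_expMeas hU hfin hpos 1

theorem zero_mem_interior_integrableExpSet (hU : U ∈ 𝓝 θ)
    (hfin : ∀ ϑ ∈ U, Integrable (fun x => exp ⟪x, ϑ⟫) ν) (hpos : 0 < ∫ x, exp ⟪x, θ⟫ ∂ν)
    (h : EucSp d) : 0 ∈ interior (integrableExpSet (fun x => ⟪x, h⟫) (expMeas ν θ)) := by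
  rw [mem_interior_iff_mem_nhds]
  have hc : Tendsto (fun t : ℝ => θ + t • h) (𝓝 0) (𝓝 θ) := by
    have : Continuous fun t : ℝ => θ + t • h := by fun_prop
    simpa using this.tendsto 0
  filter_upwards [hc hU] with t ht
  have := integrable_exp_inner_expMeas (hfin θ (mem_of_mem_nhds hU)) hpos (hfin _ ht)
  simpa only [integrableExpSet, mem_ofPred_eq, inner_smul_right] using this

theorem cgf_inner_eventuallyEq (hU : U ∈ 𝓝 θ) (hpos : ∀ ϑ ∈ U, 0 < ∫ x, exp ⟪x, ϑ⟫ ∂ν)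
    (h : EucSp d) : cgf (fun x => ⟪x, h⟫) (expMeas ν θ) =ᶠ[𝓝 0]
      fun t => psiFun ν (θ + t • h) - psiFun ν θ := by
  have hc : Tendsto (fun t : ℝ => θ + t • h) (𝓝 0) (𝓝 θ) := by
    have : Continuous fun t : ℝ => θ + t • h := by fun_prop
    simpa using this.tendsto 0
  filter_upwards [hc hU] with t ht
  have := log_integral_exp_inner_expMeas (hpos θ (mem_of_mem_nhds hU)) (hpos _ ht)
  simpa only [cgf, mgf, inner_smul_right] using this

theorem deriv_cgf_inner_eventuallyEq (hU : IsOpen U) (hθ : θ ∈ U)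
    (hfin : ∀ ϑ ∈ U, Integrable (fun x => exp ⟪x, ϑ⟫) ν)
    (hpos : ∀ ϑ ∈ U, 0 < ∫ x, exp ⟪x, ϑ⟫ ∂ν) (h : EucSp d) :
    deriv (cgf (fun x => ⟪x, h⟫) (expMeas ν θ)) =ᶠ[𝓝 0]
      fun t => ⟪gradient (psiFun ν) (θ + t • h), h⟫ := by
  have hc : Tendsto (fun t : ℝ => θ + t • h) (𝓝 0) (𝓝 θ) := by
    have : Continuous fun t : ℝ => θ + t • h := by fun_prop
    simpa using this.tendsto 0
  filter_upwards [(cgf_inner_eventuallyEq (hU.mem_nhds hθ) hpos h).eventuallyEq_nhds,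
    hc (hU.mem_nhds hθ)] with t ht htU
  rw [ht.deriv_eq, inner_gradient_left]
  have hd := differentiableAt_psiFun (hU.mem_nhds htU) hfin (hpos _ htU)
  have hl : HasDerivAt (fun t : ℝ => θ + t • h) h t := by
    simpa using ((hasDerivAt_id t).smul_const h).const_add θ
  exact ((hd.hasFDerivAt.comp_hasDerivAt t hl).sub_const _).deriv

theorem meanVec_eq_gradient (hU : IsOpen U) (hθ : θ ∈ U)
    (hfin : ∀ ϑ ∈ U, Integrable (fun x => exp ⟪x, ϑ⟫) ν)
    (hpos : ∀ ϑ ∈ U, 0 < ∫ x, exp ⟪x, ϑ⟫ ∂ν) : meanVec ν θ = gradient (psiFun ν) θ := by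
  have hN := hU.mem_nhds hθ
  have := isProbabilityMeasure_expMeas (hfin θ hθ) (hpos θ hθ)
  refine ext_inner_right ℝ fun h => ?_
  have h1 := (deriv_cgf_inner_eventuallyEq hU hθ hfin hpos h).eq_of_nhds
  rw [deriv_cgf_zero (zero_mem_interior_integrableExpSet hN hfin (hpos θ hθ) h)] at h1
  simp only [probReal_univ, div_one, zero_smul, add_zero] at h1
  rw [← h1, meanVec, real_inner_comm, ← integral_inner (integrable_id_expMeas hN hfin (hpos θ hθ))]
  simp only [real_inner_comm]

/-- The Hessian of the log-normalizer is the covariance of the exponential family. -/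
theorem inner_hessian_eq_variance (hU : IsOpen U) (hθ : θ ∈ U)
    (hfin : ∀ ϑ ∈ U, Integrable (fun x => exp ⟪x, ϑ⟫) ν)
    (hpos : ∀ ϑ ∈ U, 0 < ∫ x, exp ⟪x, ϑ⟫ ∂ν)
    (hdiff : DifferentiableAt ℝ (gradient (psiFun ν)) θ) (h : EucSp d) :
    ⟪fderiv ℝ (gradient (psiFun ν)) θ h, h⟫ =
      ∫ x, ⟪x - meanVec ν θ, h⟫ ^ 2 ∂(expMeas ν θ) := by
  have := isProbabilityMeasure_expMeas (hfin θ hθ) (hpos θ hθ)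
  have h0 := zero_mem_interior_integrableExpSet (hU.mem_nhds hθ) hfin (hpos θ hθ) h
  have hev := deriv_cgf_inner_eventuallyEq hU hθ hfin hpos h
  have h1 := iteratedDeriv_two_cgf_eq_integral h0
  have hl : HasDerivAt (fun t : ℝ => θ + t • h) h 0 := by
    simpa using ((hasDerivAt_id (0 : ℝ)).smul_const h).const_add θ
  have hd : HasFDerivAt (gradient (psiFun ν)) (fderiv ℝ (gradient (psiFun ν)) θ)
      (θ + (0 : ℝ) • h) := by
    simpa using hdiff.hasFDerivAt
  have hd' := (hd.comp_hasDerivAt (0 : ℝ) hl).inner ℝ (hasDerivAt_const (0 : ℝ) h)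
  simp only [inner_zero_right, zero_add, Function.comp_def] at hd'
  rw [iteratedDeriv_succ, iteratedDeriv_one, hev.deriv_eq, hd'.deriv, hev.eq_of_nhds] at h1
  rw [h1]
  simp [meanVec_eq_gradient hU hθ hfin hpos, inner_sub_left]

theorem integrable_norm_sub_pow_expMeas (hU : U ∈ 𝓝 θ)
    (hfin : ∀ ϑ ∈ U, Integrable (fun x => exp ⟪x, ϑ⟫) ν) (hpos : 0 < ∫ x, exp ⟪x, θ⟫ ∂ν)
    (m : EucSp d) (k : ℕ) : Integrable (fun x => ‖x - m‖ ^ k) (expMeas ν θ) := by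
  have := isProbabilityMeasure_expMeas (hfin θ (mem_of_mem_nhds hU)) hpos
  refine (((integrable_norm_pow_expMeas hU hfin hpos k).add
    (integrable_const (‖m‖ ^ k))).const_mul (2 ^ (k - 1))).mono' (by fun_prop)
    (ae_of_all _ fun x => ?_)
  rw [Real.norm_eq_abs, abs_of_nonneg (by positivity)]
  exact (pow_le_pow_left₀ (norm_nonneg _) (norm_sub_le x m) k).trans <|
    add_pow_le (norm_nonneg x) (norm_nonneg m) k

theorem integrable_abs_inner_sub_pow_expMeas (hU : U ∈ 𝓝 θ)
    (hfin : ∀ ϑ ∈ U, Integrable (fun x => exp ⟪x, ϑ⟫) ν) (hpos : 0 < ∫ x, exp ⟪x, θ⟫ ∂ν)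
    (m h : EucSp d) (k : ℕ) : Integrable (fun x => |⟪x - m, h⟫| ^ k) (expMeas ν θ) := by
  refine ((integrable_norm_sub_pow_expMeas hU hfin hpos m k).mul_const (‖h‖ ^ k)).mono'
    (by fun_prop) (ae_of_all _ fun x => ?_)
  rw [Real.norm_eq_abs, abs_of_nonneg (by positivity), ← mul_pow]
  exact pow_le_pow_left₀ (abs_nonneg _) (abs_real_inner_le_norm _ _) k

theorem integrable_exp_inner_sub_expMeas (hU : U ∈ 𝓝 θ)
    (hfin : ∀ ϑ ∈ U, Integrable (fun x => exp ⟪x, ϑ⟫) ν) (hpos : 0 < ∫ x, exp ⟪x, θ⟫ ∂ν)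
    (m : EucSp d) {h : EucSp d} (hh : θ + h ∈ U) :
    Integrable (fun x => exp ⟪x - m, h⟫) (expMeas ν θ) := by
  refine ((integrable_exp_inner_expMeas (hfin θ (mem_of_mem_nhds hU)) hpos
    (hfin _ hh)).mul_const (exp (-⟪m, h⟫))).congr (ae_of_all _ fun x => ?_)
  simp only [← Real.exp_add, inner_sub_left, ← sub_eq_add_neg]

theorem log_integral_exp_inner_sub_expMeas (hθ : θ ∈ U)
    (hfin : ∀ ϑ ∈ U, Integrable (fun x => exp ⟪x, ϑ⟫) ν)
    (hpos : ∀ ϑ ∈ U, 0 < ∫ x, exp ⟪x, ϑ⟫ ∂ν) (m : EucSp d) {h : EucSp d} (hh : θ + h ∈ U) :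
    log (∫ x, exp ⟪x - m, h⟫ ∂(expMeas ν θ)) =
      psiFun ν (θ + h) - psiFun ν θ - ⟪m, h⟫ := by
  have := isProbabilityMeasure_expMeas (hfin θ hθ) (hpos θ hθ)
  have hint := integrable_exp_inner_expMeas (hfin θ hθ) (hpos θ hθ) (hfin _ hh)
  simp only [inner_sub_left, Real.exp_sub]
  rw [integral_div, log_div (integral_exp_pos hint).ne' (exp_pos _).ne', Real.log_exp,
    log_integral_exp_inner_expMeas (hpos θ hθ) (hpos _ hh)]

variable {Θ : Set (EucSp d)} {J Jinv : EucSp d →L[ℝ] EucSp d}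

theorem inner_Jinv_apply (hJsymm : ∀ x y : EucSp d, ⟪J x, y⟫ = ⟪x, J y⟫)
    (hJinv : ∀ x : EucSp d, J (Jinv x) = x ∧ Jinv (J x) = x) (x y : EucSp d) :
    ⟪x, Jinv y⟫ = ⟪y, Jinv x⟫ := by
  conv_lhs => rw [← (hJinv x).1]
  rw [hJsymm, (hJinv y).1, real_inner_comm]

theorem B1_nonneg (n : ℕ) (c : ℝ) : 0 ≤ B1 ν Θ θ J Jinv n c := by
  refine Real.sSup_nonneg ?_
  rintro b ⟨a, ϑ, -, -, -, rfl⟩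
  exact integral_nonneg fun x => by positivity

theorem B2_nonneg (n : ℕ) (c : ℝ) : 0 ≤ B2 ν Θ θ J Jinv n c := by
  refine Real.sSup_nonneg ?_
  rintro b ⟨a, ϑ, -, -, -, rfl⟩
  exact integral_nonneg fun x => by positivity

theorem integral_abs_inner_pow_three_le_B1 (hU : U ∈ 𝓝 θ) (hθΘ : θ ∈ Θ)
    (hfin : ∀ ϑ ∈ U, Integrable (fun x => exp ⟪x, ϑ⟫) ν) (hpos : 0 < ∫ x, exp ⟪x, θ⟫ ∂ν)
    (hJsymm : ∀ x y : EucSp d, ⟪J x, y⟫ = ⟪x, J y⟫)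
    (hJinv : ∀ x : EucSp d, J (Jinv x) = x ∧ Jinv (J x) = x) (n : ℕ)
    {a : EucSp d} (ha : ‖a‖ = 1) :
    ∫ x, |⟪a, Jinv (x - meanVec ν θ)⟫| ^ 3 ∂(expMeas ν θ) ≤ B1 ν Θ θ J Jinv n 0 := by
  refine le_csSup ?_ ⟨a, θ, ha, hθΘ, by simp, rfl⟩
  refine ⟨∫ x, ‖x - meanVec ν θ‖ ^ 3 * ‖Jinv‖ ^ 3 ∂(expMeas ν θ), ?_⟩
  rintro b ⟨a', ϑ, ha', -, hϑ, rfl⟩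
  have hϑθ : ϑ = θ := by
    have h0 : J (ϑ - θ) = 0 := by
      rw [zero_mul, zero_div] at hϑ
      exact norm_eq_zero.1 (pow_eq_zero_iff two_ne_zero |>.1 (hϑ.antisymm (sq_nonneg _)))
    have := (hJinv (ϑ - θ)).2
    rw [h0, map_zero] at this
    exact (sub_eq_zero.1 this.symm)
  subst hϑθ
  refine integral_mono_of_nonneg (ae_of_all _ fun x => by positivity)
    ((integrable_norm_sub_pow_expMeas hU hfin hpos _ 3).mul_const _) (ae_of_all _ fun x => ?_)
  simp only
  rw [inner_Jinv_apply hJsymm hJinv, ← mul_pow]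
  refine pow_le_pow_left₀ (abs_nonneg _) ((abs_real_inner_le_norm _ _).trans ?_) 3
  have := Jinv.le_opNorm a'
  rw [ha', mul_one] at this
  exact mul_le_mul_of_nonneg_left this (norm_nonneg _)

/-- Quadratic lower bound for the Bregman divergence of the log-normalizer. -/
theorem mul_sq_norm_le_log_integral_exp (hU : IsOpen U) (hθ : θ ∈ U) (hθΘ : θ ∈ Θ)
    (hfin : ∀ ϑ ∈ U, Integrable (fun x => exp ⟪x, ϑ⟫) ν)
    (hpos : ∀ ϑ ∈ U, 0 < ∫ x, exp ⟪x, ϑ⟫ ∂ν)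
    (hdiff : DifferentiableAt ℝ (gradient (psiFun ν)) θ)
    (hJsymm : ∀ x y : EucSp d, ⟪J x, y⟫ = ⟪x, J y⟫)
    (hJsq : ∀ x : EucSp d, J (J x) = fderiv ℝ (gradient (psiFun ν)) θ x)
    (hJinv : ∀ x : EucSp d, J (Jinv x) = x ∧ Jinv (J x) = x) (n : ℕ)
    {h : EucSp d} (hh : θ + h ∈ U) (hJh : 0 < ‖J h‖)
    (hB : ‖J h‖ * B1 ν Θ θ J Jinv n 0 ≤ 3 / 8) :
    41 / 100 * ‖J h‖ ^ 2 ≤ log (∫ x, exp ⟪x - meanVec ν θ, h⟫ ∂(expMeas ν θ)) := by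
  have hN := hU.mem_nhds hθ
  have hprob := isProbabilityMeasure_expMeas (hfin θ hθ) (hpos θ hθ)
  set r := ‖J h‖ with hr
  set b := B1 ν Θ θ J Jinv n 0
  have hid := integrable_id_expMeas hN hfin (hpos θ hθ)
  have hid' : Integrable (fun x => x - meanVec ν θ) (expMeas ν θ) :=
    hid.sub (integrable_const _)
  have hpow := integrable_abs_inner_sub_pow_expMeas hN hfin (hpos θ hθ) (meanVec ν θ) h
  have i1 : Integrable (fun x => ⟪x - meanVec ν θ, h⟫) (expMeas ν θ) :=
    hid'.inner_const h
  have i2 : Integrable (fun x => ⟪x - meanVec ν θ, h⟫ ^ 2) (expMeas ν θ) := by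
    simpa only [sq_abs] using hpow 2
  have hvar : ∫ x, ⟪x - meanVec ν θ, h⟫ ^ 2 ∂(expMeas ν θ) = r ^ 2 := by
    rw [← inner_hessian_eq_variance hU hθ hfin hpos hdiff, ← hJsq, hJsymm,
      real_inner_self_eq_norm_sq]
  have hmean : ∫ x, ⟪x - meanVec ν θ, h⟫ ∂(expMeas ν θ) = 0 := by
    simp only [real_inner_comm h]
    rw [integral_inner hid', integral_sub hid (integrable_const _)]
    simp [meanVec]
  have h3 : ∫ x, |⟪x - meanVec ν θ, h⟫| ^ 3 ∂(expMeas ν θ) ≤ r ^ 3 * b := by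
    have ha : ‖r⁻¹ • J h‖ = 1 := by
      rw [norm_smul, norm_inv, Real.norm_of_nonneg hJh.le, inv_mul_cancel₀ hJh.ne']
    have hle := integral_abs_inner_pow_three_le_B1 hN hθΘ hfin (hpos θ hθ) hJsymm hJinv n ha
    refine le_of_eq_of_le ?_ (mul_le_mul_of_nonneg_left hle (pow_pos hJh 3).le)
    rw [← integral_const_mul]
    refine integral_congr_ae (ae_of_all _ fun x => ?_)
    simp only
    rw [inner_smul_left, hJsymm, (hJinv _).1, abs_mul, mul_pow, ← mul_assoc, ← mul_pow,
      real_inner_comm]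
    simp [abs_of_pos hJh, hJh.ne']
  have h3' : r ^ 3 ≤ ∫ x, |⟪x - meanVec ν θ, h⟫| ^ 3 ∂(expMeas ν θ) := by
    have hle : ∫ x, (3 / 2 * r * ⟪x - meanVec ν θ, h⟫ ^ 2 - r ^ 3 / 2) ∂(expMeas ν θ) ≤
        ∫ x, |⟪x - meanVec ν θ, h⟫| ^ 3 ∂(expMeas ν θ) := by
      refine integral_mono ((i2.const_mul _).sub (integrable_const _)) (hpow 3) fun x => ?_
      simp only
      rw [← sq_abs ⟪x - meanVec ν θ, h⟫]
      have := abs_nonneg ⟪x - meanVec ν θ, h⟫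
      nlinarith [mul_nonneg (sq_nonneg (|⟪x - meanVec ν θ, h⟫| - r))
        (by positivity : 0 ≤ 2 * |⟪x - meanVec ν θ, h⟫| + r)]
    rw [integral_sub (i2.const_mul _) (integrable_const _), integral_const_mul, hvar] at hle
    simp only [integral_const, probReal_univ, one_smul] at hle
    linarith
  have hb1 : 1 ≤ b := le_of_mul_le_mul_left (by linarith) (pow_pos hJh 3)
  have hr38 : r ≤ 3 / 8 := by nlinarith
  refine mul_variance_le_log_integral_exp i1 i2 (hpow 3)
    (integrable_exp_inner_sub_expMeas hN hfin (hpos θ hθ) _ hh) hmean hvar ?_ (by nlinarith)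
  nlinarith [sq_nonneg r]

theorem Zfun_le_exp (hU : IsOpen U) (hΘU : Θ ⊆ U) (hΘ : Convex ℝ Θ) (hθΘ : θ ∈ Θ)
    (hfin : ∀ ϑ ∈ U, Integrable (fun x => exp ⟪x, ϑ⟫) ν)
    (hpos : ∀ ϑ ∈ U, 0 < ∫ x, exp ⟪x, ϑ⟫ ∂ν)
    (hdiff : DifferentiableAt ℝ (gradient (psiFun ν)) θ)
    (hJsymm : ∀ x y : EucSp d, ⟪J x, y⟫ = ⟪x, J y⟫)
    (hJsq : ∀ x : EucSp d, J (J x) = fderiv ℝ (gradient (psiFun ν)) θ x)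
    (hJinv : ∀ x : EucSp d, J (Jinv x) = x ∧ Jinv (J x) = x) {n : ℕ} (hn : 0 < n)
    {R : ℝ} (hR : 0 < R) (hB : R / √n * B1 ν Θ θ J Jinv n 0 ≤ 3 / 8) (s u : EucSp d)
    (hu : R ≤ ‖u‖) :
    Zfun ν Θ θ Jinv n s u ≤
      exp (⟪u, DeltaN Jinv (gradient (psiFun ν) θ) n s⟫ - 41 / 100 * R * ‖u‖) := by
  rw [Zfun]
  split_ifs with hmem
  swap
  · exact (exp_pos _).le
  have hθ := hΘU hθΘ
  have hprob := isProbabilityMeasure_expMeas (hfin θ hθ) (hpos θ hθ)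
  have hn' : (0 : ℝ) < n := Nat.cast_pos.2 hn
  have hsn : 0 < √(n : ℝ) := Real.sqrt_pos.2 hn'
  have hsq : √(n : ℝ) * √n = n := Real.mul_self_sqrt hn'.le
  have hu0 : 0 < ‖u‖ := hR.trans_le hu
  set h := (√(n : ℝ))⁻¹ • Jinv u with hh
  set p := ‖u‖ / R with hp
  have hp1 : 1 ≤ p := (one_le_div hR).2 hu
  have hp0 : 0 < p := one_pos.trans_le hp1
  have hJh : ‖J (p⁻¹ • h)‖ = R / √n := by
    rw [hh, map_smul, map_smul, (hJinv u).1, norm_smul, norm_smul, norm_inv, norm_inv,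
      Real.norm_of_nonneg hp0.le, Real.norm_of_nonneg hsn.le, hp]
    field_simp
  have hmem' : θ + p⁻¹ • h ∈ U := by
    refine hΘU ?_
    have := hΘ.add_smul_sub_mem hθΘ hmem ⟨(inv_pos.2 hp0).le, inv_le_one_of_one_le₀ hp1⟩
    rwa [add_sub_cancel_left] at this
  have hquad := mul_sq_norm_le_log_integral_exp hU hθ hθΘ hfin hpos hdiff hJsymm hJsq hJinv n
    hmem' (by rw [hJh]; positivity) (by rwa [hJh])
  rw [hJh] at hquad
  have hconv := mul_log_integral_exp_le (P := expMeas ν θ)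
    (Y := fun x => ⟪x - meanVec ν θ, p⁻¹ • h⟫) hp1
    (integrable_exp_inner_sub_expMeas (hU.mem_nhds hθ) hfin (hpos θ hθ) _ hmem')
    (by
      simp only [← inner_smul_right, smul_inv_smul₀ hp0.ne']
      exact integrable_exp_inner_sub_expMeas (hU.mem_nhds hθ) hfin (hpos θ hθ) _ (hΘU hmem))
  simp only [← inner_smul_right _ _ p, smul_inv_smul₀ hp0.ne'] at hconv
  rw [log_integral_exp_inner_sub_expMeas hθ hfin hpos _ (hΘU hmem),
    meanVec_eq_gradient hU hθ hfin hpos] at hconv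
  rw [meanVec_eq_gradient hU hθ hfin hpos] at hquad
  have hbreg : 41 / 100 * R * ‖u‖ ≤
      n * (psiFun ν (θ + h) - psiFun ν θ - ⟪gradient (psiFun ν) θ, h⟫) := by
    refine le_trans (le_of_eq ?_) (mul_le_mul_of_nonneg_left
      ((mul_le_mul_of_nonneg_left hquad hp0.le).trans hconv) hn'.le)
    rw [hp, div_pow, Real.sq_sqrt hn'.le]
    field_simp
  have hinner : ⟪u, DeltaN Jinv (gradient (psiFun ν) θ) n s⟫ =
      (√(n : ℝ))⁻¹ * ⟪s, Jinv u⟫ - n * ⟪gradient (psiFun ν) θ, h⟫ := by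
    rw [DeltaN, inner_smul_right, inner_Jinv_apply hJsymm hJinv, inner_sub_left, inner_smul_left,
      hh, inner_smul_right]
    simp only [conj_trivial]
    field_simp
    rw [Real.sq_sqrt hn'.le]
  rw [Real.exp_le_exp, hinner]
  linarith

end ExponentialFamily

theorem exp_neg_mul_norm_le {d : ℕ} {c k : ℝ} (hc : 16 ≤ c) (hk : 1 ≤ k) {u : EucSp d}
    (hu : k * √(c * d) ≤ ‖u‖) :
    exp (-(57 / 200 * √(c * d) * ‖u‖)) ≤
      exp (-(k * c * d) / 8) * (1 / 4) ^ d * exp (-(∑ i, |u i|) / 4) := by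
  have hd : (0 : ℝ) ≤ d := Nat.cast_nonneg d
  have hR : √(c * d) * √(c * d) = c * d := Real.mul_self_sqrt (by positivity)
  have hR0 := Real.sqrt_nonneg (c * d)
  have hRd : 4 * √d ≤ √(c * d) := by
    rw [Real.sqrt_mul (by linarith)]
    refine mul_le_mul_of_nonneg_right ?_ (Real.sqrt_nonneg _)
    exact Real.le_sqrt_of_sq_le (by linarith)
  have hsum := sum_abs_le_sqrt_mul_norm u
  have h4 : exp (-(3 / 2)) ≤ 1 / 4 := by
    have h1 := Real.sum_le_exp_of_nonneg (x := 3 / 2) (by norm_num) 5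
    simp only [Finset.sum_range_succ, Finset.sum_range_zero, Nat.factorial] at h1
    norm_num at h1
    rw [Real.exp_neg, one_div]
    exact inv_anti₀ (by norm_num) (by linarith)
  have h4d : exp (-(3 / 2) * d) ≤ (1 / 4) ^ d := by
    rw [mul_comm, Real.exp_nat_mul]
    exact pow_le_pow_left₀ (exp_pos _).le h4 d
  have hRu : k * (c * d) ≤ √(c * d) * ‖u‖ := by
    have := mul_le_mul_of_nonneg_left hu hR0
    nlinarith
  have hcd : 16 * (d : ℝ) ≤ c * d := mul_le_mul_of_nonneg_right hc hd
  have hkcd : c * d ≤ k * (c * d) := le_mul_of_one_le_left (by positivity) hk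
  have hs : 4 * ∑ i, |u i| ≤ √(c * d) * ‖u‖ := by
    have := mul_le_mul_of_nonneg_right hRd (norm_nonneg u)
    linarith
  calc exp (-(57 / 200 * √(c * d) * ‖u‖))
      ≤ exp (-(k * c * d) / 8 + -(3 / 2) * d + -(∑ i, |u i|) / 4) := by
        rw [Real.exp_le_exp]
        linarith
    _ = exp (-(k * c * d) / 8) * exp (-(3 / 2) * d) * exp (-(∑ i, |u i|) / 4) := by
        rw [Real.exp_add, Real.exp_add]
    _ ≤ _ := by gcongr

/-- **Theorem (Statement 5).** Tail bound for the posterior numerator: if `‖Δ_n‖² < C₁d`,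
`λ_n(c) < 1/16` and `c > 16·max{4C₁, 1/(1 − 2λ_n(c))}`, then for every `k ≥ 1`,
`∫_{‖u‖ ≥ k√(cd)} π(θ₀ + n^{-1/2}J⁻¹u)·Z_n(u) du
  ≤ (sup_θ π(θ))·e^{cd·λ_n(c)}·(∫ Z̃_n(u) du)·e^{−kcd/8}`. -/
theorem posterior_numerator_tail_bound {d n : ℕ}
    (ν : Measure (EucSp d)) [SigmaFinite ν]
    (Θ : Set (EucSp d)) (hΘopen : IsOpen Θ) (hΘconv : Convex ℝ Θ)
    -- ψ is finite on an open set containing Θ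
    (U : Set (EucSp d)) (hUopen : IsOpen U) (hΘU : Θ ⊆ U)
    (hfin : ∀ ϑ ∈ U, Integrable (fun x => Real.exp ⟪x, ϑ⟫) ν)
    (hpos : ∀ ϑ ∈ U, 0 < ∫ x, Real.exp ⟪x, ϑ⟫ ∂ν)
    (θ₀ : EucSp d) (hθ₀ : θ₀ ∈ Θ) (hn : 0 < n)
    -- J = F^{1/2} is the symmetric square root of F = ∇²ψ(θ₀), with inverse J⁻¹
    (J Jinv : EucSp d →L[ℝ] EucSp d)
    (hJsymm : ∀ x y : EucSp d, ⟪J x, y⟫ = ⟪x, J y⟫)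
    (hJsq : ∀ x : EucSp d, J (J x) = fderiv ℝ (gradient (psiFun ν)) θ₀ x)
    (hFpos : ∀ x : EucSp d, x ≠ 0 → 0 < ⟪x, fderiv ℝ (gradient (psiFun ν)) θ₀ x⟫)
    (hJinv : ∀ x : EucSp d, J (Jinv x) = x ∧ Jinv (J x) = x)
    -- π is a bounded prior density on Θ, extended by 0 outside Θ
    (prior : EucSp d → ℝ) (hprior₀ : ∀ θ, 0 ≤ prior θ)
    (hpriorΘ : ∀ θ ∉ Θ, prior θ = 0) (hpriorBdd : BddAbove (Set.range prior))
    -- s = Σᵢ Xᵢ is the data total, so that Δ_n = √n·J⁻¹(X̄_n − μ) with μ = ∇ψ(θ₀)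
    (s : EucSp d)
    (C₁ c k : ℝ)
    (hΔ : ‖DeltaN Jinv (gradient (psiFun ν) θ₀) n s‖ ^ 2 < C₁ * d)
    (hlam : lamN ν Θ θ₀ J Jinv n c < 1 / 16)
    (hc : c > 16 * max (4 * C₁) (1 / (1 - 2 * lamN ν Θ θ₀ J Jinv n c)))
    (hk : 1 ≤ k) :
    ∫ u in {u : EucSp d | k * Real.sqrt (c * d) ≤ ‖u‖},
        prior (θ₀ + (Real.sqrt n)⁻¹ • Jinv u) * Zfun ν Θ θ₀ Jinv n s u ≤
      sSup (Set.range prior) * Real.exp (c * d * lamN ν Θ θ₀ J Jinv n c) *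
        (∫ u : EucSp d, Ztil (DeltaN Jinv (gradient (psiFun ν) θ₀) n s) u) *
        Real.exp (-(k * c * d) / 8) := by
  have hd : 0 < (d : ℝ) := by
    rcases Nat.eq_zero_or_pos d with h | h
    · subst h
      have := (sq_nonneg _).trans_lt hΔ
      simp at this
    · exact Nat.cast_pos.2 h
  have hn' : (0 : ℝ) < n := Nat.cast_pos.2 hn
  have hdiff : DifferentiableAt ℝ (gradient (psiFun ν)) θ₀ := by
    by_contra hcon
    have h := hFpos (EuclideanSpace.single ⟨0, Nat.cast_pos.1 hd⟩ 1) (by simp)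
    rw [fderiv_zero_of_not_differentiableAt hcon] at h
    simp at h
  have hC₁ : 0 < C₁ := pos_of_mul_pos_left ((sq_nonneg _).trans_lt hΔ) hd.le
  have hc64 : 64 * C₁ < c := by
    have := le_max_left (4 * C₁) (1 / (1 - 2 * lamN ν Θ θ₀ J Jinv n c))
    linarith
  have hc0 : 0 < c := by linarith
  have hcdn : 0 ≤ c * d / n := by positivity
  have hB1 := B1_nonneg (ν := ν) (Θ := Θ) (θ := θ₀) (J := J) (Jinv := Jinv) n 0
  have hB2 := mul_nonneg hcdn (B2_nonneg (ν := ν) (Θ := Θ) (θ := θ₀) (J := J) (Jinv := Jinv) n c)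
  have hlam0 : 0 ≤ lamN ν Θ θ₀ J Jinv n c := by
    rw [lamN]
    have := mul_nonneg (Real.sqrt_nonneg (c * d / n)) hB1
    positivity
  have hc16 : 16 ≤ c := by
    have h1 := le_max_right (4 * C₁) (1 / (1 - 2 * lamN ν Θ θ₀ J Jinv n c))
    have h2 : 1 ≤ 1 / (1 - 2 * lamN ν Θ θ₀ J Jinv n c) :=
      one_le_one_div (by linarith) (by linarith)
    linarith
  set Δ := DeltaN Jinv (gradient (psiFun ν) θ₀) n s with hΔdef
  set R := √(c * d) with hRdef
  have hR : 0 < R := Real.sqrt_pos.2 (by positivity)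
  have hRsq : R ^ 2 = c * d := Real.sq_sqrt (by positivity)
  have hB : R / √n * B1 ν Θ θ₀ J Jinv n 0 ≤ 3 / 8 := by
    rw [hRdef, ← Real.sqrt_div (by positivity)]
    rw [lamN] at hlam
    linarith
  have hΔR : ‖Δ‖ ≤ R / 8 := by
    refine abs_le_of_sq_le_sq' ?_ (by positivity) |>.2
    rw [div_pow, hRsq]
    have := mul_lt_mul_of_pos_right hc64 hd
    linarith
  set M := sSup (Set.range prior)
  have hM : ∀ θ, prior θ ≤ M := fun θ => le_csSup hpriorBdd ⟨θ, rfl⟩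
  have hM0 : 0 ≤ M := (hprior₀ θ₀).trans (hM θ₀)
  have hZ0 : ∀ u, 0 ≤ Zfun ν Θ θ₀ Jinv n s u := by
    intro u
    rw [Zfun]
    split_ifs
    · exact (exp_pos _).le
    · exact le_rfl
  set G : EucSp d → ℝ := fun u =>
    M * (exp (-(k * c * d) / 8) * (1 / 4) ^ d * exp (-(∑ i, |u i|) / 4))
  have hG : Integrable G := ((integrable_exp_neg_sum_abs d).const_mul _).const_mul M
  have hbound : ∀ u ∈ {u : EucSp d | k * R ≤ ‖u‖},
      prior (θ₀ + (√n)⁻¹ • Jinv u) * Zfun ν Θ θ₀ Jinv n s u ≤ G u := by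
    intro u hu
    refine mul_le_mul (hM _) ?_ (hZ0 u) hM0
    have hRu : R ≤ ‖u‖ := (le_mul_of_one_le_left hR.le hk).trans hu
    refine (Zfun_le_exp hUopen hΘU hΘconv hθ₀ hfin hpos hdiff hJsymm hJsq hJinv hn hR hB s u
      hRu).trans ((Real.exp_le_exp.2 ?_).trans (exp_neg_mul_norm_le hc16 hk hu))
    have h1 := real_inner_le_norm u Δ
    have h2 := mul_le_mul_of_nonneg_left hΔR (norm_nonneg u)
    rw [← hRdef]
    linarith
  have hS : MeasurableSet {u : EucSp d | k * R ≤ ‖u‖} :=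
    measurableSet_le measurable_const measurable_norm
  calc _ ≤ ∫ u in {u : EucSp d | k * R ≤ ‖u‖}, G u :=
        integral_mono_of_nonneg (ae_of_all _ fun u => mul_nonneg (hprior₀ _) (hZ0 u))
          hG.integrableOn (ae_restrict_of_forall_mem hS hbound)
    _ ≤ ∫ u, G u := setIntegral_le_integral hG (ae_of_all _ fun u => by positivity)
    _ = M * 1 * 2 ^ d * exp (-(k * c * d) / 8) := by
        rw [integral_const_mul, integral_const_mul, integral_exp_neg_sum_abs, mul_assoc (exp _),
          ← mul_pow]
        norm_num
        ring
    _ ≤ M * exp (c * d * lamN ν Θ θ₀ J Jinv n c) * (∫ u, Ztil Δ u) * exp (-(k * c * d) / 8) := by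
        gcongr
        · exact Real.one_le_exp (by positivity)
        · exact two_pow_le_integral_Ztil Δ
end
end

section
/- Reverse Hölder inequality for log-concave vectors (Lovász–Vempala): if X is a random vector in ℝ^d whose distribution is log-concave, then for every k ≥ 1, E[‖X‖^k]^{1/k} ≤ 2k·E[‖X‖] ≤ 2k·E[‖X‖²]^{1/2}. -/
open MeasureTheory Filter Real Set
open scoped ENNReal RealInnerProductSpace BigOperators

noncomputable section

/-- A nonnegative function `h` is a log-concave density kernel if
`h(λx + (1−λ)y) ≥ h(x)^λ·h(y)^{1−λ}` for all `x, y` and `λ ∈ [0,1]`. -/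
def IsLogConcaveFun {d : ℕ} (h : EucSp d → ℝ) : Prop :=
  (∀ x, 0 ≤ h x) ∧
    ∀ x y : EucSp d, ∀ t ∈ Set.Icc (0:ℝ) 1,
      h x ^ t * h y ^ (1 - t) ≤ h (t • x + (1 - t) • y)

/-- A measure on `ℝ^d` is log-concave if it has a log-concave density with respect to
Lebesgue measure. -/
def IsLogConcaveMeasure {d : ℕ} (μ : Measure (EucSp d)) : Prop :=
  ∃ h : EucSp d → ℝ, IsLogConcaveFun h ∧
    μ = volume.withDensity fun x => ENNReal.ofReal (h x)

open scoped Pointwise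

/-! ### The Prékopa–Leindler inequality -/

/-- The Prékopa–Leindler inequality holds on the measure space `E`. -/
def PrekopaLeindler (E : Type*) [AddCommMonoid E] [Module ℝ E] [MeasureSpace E] : Prop :=
  ∀ (t : ℝ), 0 < t → t < 1 → ∀ f g h : E → ℝ≥0∞, Measurable f → Measurable g → Measurable h →
    (∀ x y, f x ^ t * g y ^ (1 - t) ≤ h (t • x + (1 - t) • y)) →
    (∫⁻ x, f x) ^ t * (∫⁻ x, g x) ^ (1 - t) ≤ ∫⁻ x, h x

theorem IsCompact.volume_add_volume_le {K L C : Set ℝ} (hK : IsCompact K) (hL : IsCompact L)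
    (hK' : K.Nonempty) (hL' : L.Nonempty) (hC : ∀ x ∈ K, ∀ y ∈ L, x + y ∈ C) :
    volume K + volume L ≤ volume C := by
  obtain ⟨a, haK, ha⟩ := hK.exists_isGreatest hK'
  obtain ⟨b, hbL, hb⟩ := hL.exists_isLeast hL'
  have h1 : volume ((fun x => x + b) '' K) = volume K := by
    rw [image_add_right, measure_preimage_add_right]
  have h2 : volume ((fun y => a + y) '' L) = volume L := by
    rw [image_add_left, measure_preimage_add]
  have hsub : (fun x => x + b) '' K ∩ (fun y => a + y) '' L ⊆ {a + b} := by
    rintro _ ⟨⟨x, hx, rfl⟩, y, hy, hxy⟩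
    have := ha hx
    have := hb hy
    simp only [mem_singleton_iff] at hxy ⊢
    linarith
  have hd : AEDisjoint volume ((fun x => x + b) '' K) ((fun y => a + y) '' L) :=
    measure_mono_null hsub (by simp)
  have hm : MeasurableSet ((fun y => a + y) '' L) :=
    (hL.image (by fun_prop)).isClosed.measurableSet
  rw [← h1, ← h2, ← measure_union₀ hm.nullMeasurableSet hd]
  refine measure_mono (union_subset ?_ ?_)
  · rintro _ ⟨x, hx, rfl⟩
    exact hC x hx b hbL
  · rintro _ ⟨y, hy, rfl⟩
    exact hC a haK y hy

theorem MeasurableSet.volume_add_volume_le {A B C : Set ℝ} (hA : MeasurableSet A)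
    (hB : MeasurableSet B) (hA' : A.Nonempty) (hB' : B.Nonempty)
    (hC : ∀ x ∈ A, ∀ y ∈ B, x + y ∈ C) :
    volume A + volume B ≤ volume C := by
  obtain ⟨a, ha⟩ := hA'
  obtain ⟨b, hb⟩ := hB'
  rw [hA.measure_eq_iSup_isCompact, hB.measure_eq_iSup_isCompact]
  simp only [iSup_and']
  refine ENNReal.biSup_add_biSup_le' ⟨∅, by simp⟩ ⟨∅, by simp⟩ fun K ⟨hKA, hK⟩ L ⟨hLB, hL⟩ => ?_
  calc volume K + volume L ≤ volume (insert a K) + volume (insert b L) :=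
        add_le_add (measure_mono (subset_insert a K)) (measure_mono (subset_insert b L))
    _ ≤ volume C := (hK.insert a).volume_add_volume_le (hL.insert b) (insert_nonempty a K)
        (insert_nonempty b L) fun x hx y hy =>
          hC x (insert_subset ha hKA hx) y (insert_subset hb hLB hy)

theorem MeasurableSet.weighted_volume_add_volume_le {A B C : Set ℝ} {t : ℝ} (ht0 : 0 < t)
    (ht1 : t < 1) (hA : MeasurableSet A)
    (hB : MeasurableSet B) (hA' : A.Nonempty) (hB' : B.Nonempty)
    (hC : ∀ x ∈ A, ∀ y ∈ B, t * x + (1 - t) * y ∈ C) :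
    ENNReal.ofReal t * volume A + ENNReal.ofReal (1 - t) * volume B ≤ volume C := by
  have ht1' : 0 < 1 - t := sub_pos.2 ht1
  have key := MeasurableSet.volume_add_volume_le (A := t • A) (B := (1 - t) • B) (C := C)
    (hA.const_smul₀ t) (hB.const_smul₀ _) hA'.smul_set hB'.smul_set (by
      rintro _ ⟨x, hx, rfl⟩ _ ⟨y, hy, rfl⟩
      exact hC x hx y hy)
  simpa [Measure.addHaar_smul, abs_of_pos ht0, abs_of_pos ht1'] using key

theorem weighted_lintegral_add_le_lintegral {t : ℝ} (ht0 : 0 < t) (ht1 : t < 1) {f g h : ℝ → ℝ}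
    (hf : Measurable f) (hg : Measurable g) (hh : Measurable h)
    (hf0 : ∀ x, 0 ≤ f x) (hg0 : ∀ x, 0 ≤ g x) (hh0 : ∀ x, 0 ≤ h x)
    (hf1 : ∀ x, f x ≤ 1) (hg1 : ∀ x, g x ≤ 1)
    (hf1' : ∀ s < 1, ∃ x, s < f x) (hg1' : ∀ s < 1, ∃ x, s < g x)
    (H : ∀ x y, f x ^ t * g y ^ (1 - t) ≤ h (t * x + (1 - t) * y)) :
    ENNReal.ofReal t * (∫⁻ x, ENNReal.ofReal (f x)) +
      ENNReal.ofReal (1 - t) * (∫⁻ x, ENNReal.ofReal (g x)) ≤ ∫⁻ x, ENNReal.ofReal (h x) := by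
  have ht1' : 0 < 1 - t := sub_pos.2 ht1
  have mf : Measurable fun s : ℝ => volume {a | s < f a} :=
    Antitone.measurable fun a b hab => measure_mono fun x hx => lt_of_le_of_lt hab hx
  have mg : Measurable fun s : ℝ => volume {a | s < g a} :=
    Antitone.measurable fun a b hab => measure_mono fun x hx => lt_of_le_of_lt hab hx
  rw [lintegral_eq_lintegral_meas_lt _ (ae_of_all _ hf0) hf.aemeasurable,
    lintegral_eq_lintegral_meas_lt _ (ae_of_all _ hg0) hg.aemeasurable,
    lintegral_eq_lintegral_meas_lt _ (ae_of_all _ hh0) hh.aemeasurable,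
    ← lintegral_const_mul _ mf, ← lintegral_const_mul _ mg,
    ← lintegral_add_left (mf.const_mul _)]
  refine setLIntegral_mono' measurableSet_Ioi fun s hs => ?_
  rcases lt_or_ge s 1 with hs1 | hs1
  · refine MeasurableSet.weighted_volume_add_volume_le ht0 ht1 (measurableSet_lt measurable_const hf)
      (measurableSet_lt measurable_const hg) (hf1' s hs1) (hg1' s hs1) fun x hx y hy => ?_
    refine lt_of_lt_of_le ?_ (H x y)
    have hs0 : (0 : ℝ) < s := hs
    calc s = s ^ t * s ^ (1 - t) := by rw [← rpow_add hs0]; simp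
      _ < f x ^ t * g y ^ (1 - t) :=
        mul_lt_mul'' (rpow_lt_rpow hs0.le hx ht0) (rpow_lt_rpow hs0.le hy ht1')
          (by positivity) (by positivity)
  · have e1 : {a | s < f a} = ∅ := by
      ext a; simpa using (hf1 a).trans hs1
    have e2 : {a | s < g a} = ∅ := by
      ext a; simpa using (hg1 a).trans hs1
    simp [e1, e2]

theorem ENNReal.rpow_mul_rpow_le_weighted_add {t : ℝ} (ht0 : 0 < t) (ht1 : t < 1) (a b : ℝ≥0∞) :
    a ^ t * b ^ (1 - t) ≤ ENNReal.ofReal t * a + ENNReal.ofReal (1 - t) * b := by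
  have ht1' : 0 < 1 - t := sub_pos.2 ht1
  have hpq : (1 / t).HolderConjugate (1 / (1 - t)) := by
    rw [Real.holderConjugate_iff]
    refine ⟨by rw [lt_div_iff₀ ht0]; linarith, by simp⟩
  refine (ENNReal.young_inequality (a ^ t) (b ^ (1 - t)) hpq).trans (le_of_eq ?_)
  rw [← ENNReal.rpow_mul, ← ENNReal.rpow_mul, mul_one_div_cancel ht0.ne',
    mul_one_div_cancel ht1'.ne', ENNReal.rpow_one, ENNReal.rpow_one, one_div, one_div,
    div_eq_mul_inv, div_eq_mul_inv, ENNReal.ofReal_inv_of_pos ht0,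
    ENNReal.ofReal_inv_of_pos ht1', inv_inv, inv_inv, mul_comm, mul_comm b]

theorem exists_scale_to_sup_one {f : ℝ → ℝ} {c : ℝ} (hfc : ∀ x, f x ≤ c)
    {x₀ : ℝ} (hx₀ : 0 < f x₀) :
    ∃ M, 0 < M ∧ (∀ x, f x / M ≤ 1) ∧ ∀ s < 1, ∃ x, s < f x / M := by
  have hb : BddAbove (range f) := ⟨c, by rintro _ ⟨x, rfl⟩; exact hfc x⟩
  have hM : 0 < ⨆ x, f x := hx₀.trans_le (le_ciSup hb x₀)
  refine ⟨⨆ x, f x, hM, fun x => (div_le_one hM).2 (le_ciSup hb x), fun s hs => ?_⟩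
  obtain ⟨x, hx⟩ := exists_lt_of_lt_ciSup (show s * (⨆ x, f x) < ⨆ x, f x by nlinarith)
  exact ⟨x, (lt_div_iff₀ hM).2 hx⟩

theorem prekopaLeindler_real_of_bounded {t : ℝ} (ht0 : 0 < t) (ht1 : t < 1) {f g h : ℝ → ℝ}
    {c : ℝ} (hf : Measurable f) (hg : Measurable g) (hh : Measurable h)
    (hf0 : ∀ x, 0 ≤ f x) (hg0 : ∀ x, 0 ≤ g x) (hh0 : ∀ x, 0 ≤ h x)
    (hfc : ∀ x, f x ≤ c) (hgc : ∀ x, g x ≤ c)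
    (H : ∀ x y, f x ^ t * g y ^ (1 - t) ≤ h (t * x + (1 - t) * y)) :
    (∫⁻ x, ENNReal.ofReal (f x)) ^ t * (∫⁻ x, ENNReal.ofReal (g x)) ^ (1 - t) ≤
      ∫⁻ x, ENNReal.ofReal (h x) := by
  have ht1' : 0 < 1 - t := sub_pos.2 ht1
  by_cases hfz : ∀ x, f x ≤ 0
  · simp [fun x => le_antisymm (hfz x) (hf0 x), ht0]
  by_cases hgz : ∀ x, g x ≤ 0
  · simp [fun x => le_antisymm (hgz x) (hg0 x), ht1]
  push Not at hfz hgz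
  obtain ⟨x₀, hx₀⟩ := hfz
  obtain ⟨y₀, hy₀⟩ := hgz
  obtain ⟨M, hM, hM1, hM2⟩ := exists_scale_to_sup_one hfc hx₀
  obtain ⟨N, hN, hN1, hN2⟩ := exists_scale_to_sup_one hgc hy₀
  have hMN : 0 < M ^ t * N ^ (1 - t) := by positivity
  have key := weighted_lintegral_add_le_lintegral ht0 ht1 (hf.div_const M) (hg.div_const N)
    (hh.div_const (M ^ t * N ^ (1 - t))) (fun x => div_nonneg (hf0 x) hM.le)
    (fun x => div_nonneg (hg0 x) hN.le) (fun x => div_nonneg (hh0 x) hMN.le) hM1 hN1 hM2 hN2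
    (fun x y => by
      rw [div_rpow (hf0 x) hM.le, div_rpow (hg0 y) hN.le, div_mul_div_comm]
      exact div_le_div_of_nonneg_right (H x y) hMN.le)
  have scale : ∀ (u : ℝ → ℝ) (K : ℝ), 0 < K → Measurable u → (∀ x, 0 ≤ u x) →
      ∫⁻ x, ENNReal.ofReal (u x) = ENNReal.ofReal K * ∫⁻ x, ENNReal.ofReal (u x / K) := by
    intro u K hK hu hu0
    rw [← lintegral_const_mul _ (by fun_prop)]
    refine lintegral_congr fun x => ?_
    rw [← ENNReal.ofReal_mul hK.le, mul_div_cancel₀ _ hK.ne']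
  rw [scale f M hM hf hf0, scale g N hN hg hg0, scale h _ hMN hh hh0,
    ENNReal.mul_rpow_of_nonneg _ _ ht0.le, ENNReal.mul_rpow_of_nonneg _ _ ht1'.le,
    mul_mul_mul_comm, ENNReal.ofReal_rpow_of_pos hM, ENNReal.ofReal_rpow_of_pos hN,
    ← ENNReal.ofReal_mul (by positivity)]
  gcongr
  exact (ENNReal.rpow_mul_rpow_le_weighted_add ht0 ht1 _ _).trans key

theorem ENNReal.tendsto_lintegral_min_natCast {f : ℝ → ℝ≥0∞} (hf : Measurable f) :
    Tendsto (fun n : ℕ => ∫⁻ x, min (f x) n) atTop (nhds (∫⁻ x, f x)) := by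
  refine lintegral_tendsto_of_tendsto_of_monotone (fun n => by fun_prop)
    (ae_of_all _ fun x m n hmn => min_le_min_left _ (by exact_mod_cast hmn))
    (ae_of_all _ fun x => ?_)
  simpa using (tendsto_const_nhds (x := f x)).min ENNReal.tendsto_nat_nhds_top

theorem prekopaLeindler_real : PrekopaLeindler ℝ := by
  intro t ht0 ht1 f g h hf hg hh H
  have ht1' : 0 < 1 - t := sub_pos.2 ht1
  by_cases hA : ∫⁻ x, f x = 0
  · simp [hA, ht0]
  by_cases hB : ∫⁻ x, g x = 0
  · simp [hB, ht1]
  have lim : Tendsto (fun n : ℕ => (∫⁻ x, min (f x) n) ^ t * (∫⁻ x, min (g x) n) ^ (1 - t)) atTop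
      (nhds ((∫⁻ x, f x) ^ t * (∫⁻ x, g x) ^ (1 - t))) := by
    refine ENNReal.Tendsto.mul ((ENNReal.tendsto_lintegral_min_natCast hf).ennrpow_const t) ?_
      ((ENNReal.tendsto_lintegral_min_natCast hg).ennrpow_const _) ?_
    · left; simp [hA, ht0, ht0.le]
    · left; simp [hB, ht1, ht1.le]
  refine le_of_tendsto' lim fun n => ?_
  have hne : ∀ a : ℝ≥0∞, min a n ≠ ⊤ := fun a => ne_top_of_le_ne_top (by simp) (min_le_right _ _)
  have key := prekopaLeindler_real_of_bounded ht0 ht1 (f := fun x => (min (f x) n).toReal)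
    (g := fun x => (min (g x) n).toReal) (h := fun x => (min (h x) n).toReal) (c := n)
    (by fun_prop) (by fun_prop) (by fun_prop) (by simp) (by simp) (by simp)
    (fun x => ENNReal.toReal_le_of_le_ofReal (by simp) (by simp))
    (fun x => ENNReal.toReal_le_of_le_ofReal (by simp) (by simp)) (fun x y => by
      rw [ENNReal.toReal_rpow, ENNReal.toReal_rpow, ← ENNReal.toReal_mul]
      refine ENNReal.toReal_mono (hne _) (le_min ?_ ?_)
      · refine le_trans ?_ (H x y)
        gcongr <;> exact min_le_left _ _
      · calc _ ≤ (n : ℝ≥0∞) ^ t * (n : ℝ≥0∞) ^ (1 - t) := by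
              gcongr <;> exact min_le_right _ _
          _ = n := by rw [← ENNReal.rpow_add_of_nonneg _ _ ht0.le ht1'.le]; simp)
  simp only [ENNReal.ofReal_toReal (hne _)] at key
  exact key.trans (lintegral_mono fun x => min_le_left _ _)

theorem PrekopaLeindler.prod {E F : Type*} [AddCommMonoid E] [Module ℝ E] [MeasureSpace E]
    [AddCommMonoid F] [Module ℝ F] [MeasureSpace F] [SFinite (volume : Measure F)]
    (hE : PrekopaLeindler E) (hF : PrekopaLeindler F) : PrekopaLeindler (E × F) := by
  intro t ht0 ht1 f g h hf hg hh H
  rw [Measure.volume_eq_prod, lintegral_prod _ hf.aemeasurable, lintegral_prod _ hg.aemeasurable,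
    lintegral_prod _ hh.aemeasurable]
  refine hE t ht0 ht1 _ _ _ hf.lintegral_prod_right' hg.lintegral_prod_right'
    hh.lintegral_prod_right' fun x y => ?_
  exact hF t ht0 ht1 _ _ _ (by fun_prop) (by fun_prop) (by fun_prop)
    fun x' y' => H (x, x') (y, y')

theorem PrekopaLeindler.of_measurePreserving {E F : Type*} [AddCommMonoid E] [Module ℝ E]
    [MeasureSpace E] [AddCommMonoid F] [Module ℝ F] [MeasureSpace F] (hE : PrekopaLeindler E)
    (e : E →ₗ[ℝ] F) (he : MeasurePreserving e volume volume) : PrekopaLeindler F := by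
  intro t ht0 ht1 f g h hf hg hh H
  rw [← he.lintegral_comp hf, ← he.lintegral_comp hg, ← he.lintegral_comp hh]
  refine hE t ht0 ht1 _ _ _ (hf.comp he.measurable) (hg.comp he.measurable)
    (hh.comp he.measurable) fun x y => ?_
  simpa using H (e x) (e y)

theorem prekopaLeindler_pi : ∀ n : ℕ, PrekopaLeindler (Fin n → ℝ)
  | 0 => by
    intro t ht0 ht1 f g h hf hg hh H
    rw [Measure.volume_pi_eq_dirac (0 : Fin 0 → ℝ), lintegral_dirac, lintegral_dirac,
      lintegral_dirac]
    exact (H 0 0).trans_eq (congrArg h (Subsingleton.elim _ _))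
  | n + 1 =>
    (prekopaLeindler_real.prod (prekopaLeindler_pi n)).of_measurePreserving
      (Fin.consLinearEquiv ℝ (fun _ : Fin (n + 1) => ℝ)).toLinearMap
      (by
        have e : ⇑(Fin.consLinearEquiv ℝ (fun _ : Fin (n + 1) => ℝ)) =
            (MeasurableEquiv.piFinSuccAbove (fun _ : Fin (n + 1) => ℝ) 0).symm := by
          funext x
          ext i
          refine Fin.cases ?_ (fun j => ?_) i <;> simp [Fin.consLinearEquiv, Fin.consEquiv]
        have := (volume_preserving_piFinSuccAbove (fun _ : Fin (n + 1) => ℝ) 0).symm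
        rw [← e] at this
        exact this)

theorem prekopaLeindler_euclideanSpace (d : ℕ) : PrekopaLeindler (EuclideanSpace ℝ (Fin d)) :=
  (prekopaLeindler_pi d).of_measurePreserving
    (WithLp.linearEquiv 2 ℝ (Fin d → ℝ)).symm.toLinearMap (PiLp.volume_preserving_toLp (Fin d))

/-! ### Tails of log-concave measures -/

theorem IsLogConcaveFun.exists_measurable_ae_eq {d : ℕ} {h : EucSp d → ℝ}
    (hh : IsLogConcaveFun h) :
    ∃ g : EucSp d → ℝ, Measurable g ∧ g =ᵐ[volume] h ∧ (∀ x, 0 ≤ g x) ∧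
      ∀ x y : EucSp d, ∀ t ∈ Ioo (0 : ℝ) 1, g x ^ t * g y ^ (1 - t) ≤ g (t • x + (1 - t) • y) := by
  obtain ⟨h0, hlc⟩ := hh
  set C : Set (EucSp d) := {x | 0 < h x} with hC
  have hconv : Convex ℝ C := by
    intro x hx y hy a b ha hb hab
    obtain rfl : b = 1 - a := by linarith
    have hx' : 0 < h x := hx
    have hy' : 0 < h y := hy
    exact lt_of_lt_of_le (by positivity) (hlc x y a ⟨ha, by linarith⟩)
  have hint : ∀ {x}, x ∈ interior C → 0 < h x := fun hx => (interior_subset hx : _ ∈ C)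
  have hconc : ConcaveOn ℝ (interior C) fun x => log (h x) := by
    refine ⟨hconv.interior, fun x hx y hy a b ha hb hab => ?_⟩
    obtain rfl : b = 1 - a := by linarith
    have hx' := hint hx
    have hy' := hint hy
    have := log_le_log (by positivity) (hlc x y a ⟨ha, by linarith⟩)
    rwa [log_mul (by positivity) (by positivity), log_rpow hx', log_rpow hy'] at this
  have hcont : ContinuousOn h (interior C) :=
    ((hconc.continuousOn isOpen_interior).rexp).congr fun x hx => (exp_log (hint hx)).symm
  refine ⟨(interior C).indicator h, ?_, ?_, fun x => indicator_nonneg (fun x _ => h0 x) x, ?_⟩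
  · classical
    rw [← piecewise_eq_indicator]
    exact hcont.measurable_piecewise continuousOn_const isOpen_interior.measurableSet
  · have : volume (frontier C) = 0 := hconv.addHaar_frontier volume
    filter_upwards [measure_eq_zero_iff_ae_notMem.1 this] with x hx
    by_cases hxi : x ∈ interior C
    · rw [indicator_of_mem hxi]
    · have hxC : x ∉ C := fun hxC => hx ⟨subset_closure hxC, hxi⟩
      rw [indicator_of_notMem hxi]
      exact le_antisymm (h0 x) (not_lt.1 hxC)
  · rintro x y t ⟨ht0, ht1⟩
    by_cases hx : x ∈ interior C
    · by_cases hy : y ∈ interior C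
      · rw [indicator_of_mem hx, indicator_of_mem hy, indicator_of_mem
          (hconv.interior hx hy ht0.le (sub_nonneg.2 ht1.le) (by ring))]
        exact hlc x y t ⟨ht0.le, ht1.le⟩
      · rw [indicator_of_notMem hy, zero_rpow (sub_pos.2 ht1).ne', mul_zero]
        exact indicator_nonneg (fun x _ => h0 x) _
    · rw [indicator_of_notMem hx, zero_rpow ht0.ne', zero_mul]
      exact indicator_nonneg (fun x _ => h0 x) _

theorem IsLogConcaveMeasure.measure_rpow_mul_measure_rpow_le {d : ℕ} {μ : Measure (EucSp d)}
    (hμ : IsLogConcaveMeasure μ) {t : ℝ} (ht0 : 0 < t) (ht1 : t < 1) {A B C : Set (EucSp d)}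
    (hA : MeasurableSet A) (hB : MeasurableSet B) (hC : MeasurableSet C)
    (hABC : ∀ x ∈ A, ∀ y ∈ B, t • x + (1 - t) • y ∈ C) :
    μ A ^ t * μ B ^ (1 - t) ≤ μ C := by
  obtain ⟨h, hh, rfl⟩ := hμ
  obtain ⟨g, hg, hgh, hg0, hglc⟩ := hh.exists_measurable_ae_eq
  have hae : (fun x => ENNReal.ofReal (h x)) =ᵐ[volume] fun x => ENNReal.ofReal (g x) := by
    filter_upwards [hgh] with x hx
    rw [hx]
  rw [withDensity_congr_ae hae, withDensity_apply _ hA, withDensity_apply _ hB,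
    withDensity_apply _ hC, ← lintegral_indicator hA, ← lintegral_indicator hB,
    ← lintegral_indicator hC]
  have ht1' : 0 < 1 - t := sub_pos.2 ht1
  have hg' : Measurable fun x => ENNReal.ofReal (g x) := hg.ennreal_ofReal
  refine prekopaLeindler_euclideanSpace d t ht0 ht1 _ _ _ (hg'.indicator hA) (hg'.indicator hB)
    (hg'.indicator hC) fun x y => ?_
  by_cases hx : x ∈ A
  · by_cases hy : y ∈ B
    · rw [indicator_of_mem hx, indicator_of_mem hy, indicator_of_mem (hABC x hx y hy),
        ENNReal.ofReal_rpow_of_nonneg (hg0 x) ht0.le, ENNReal.ofReal_rpow_of_nonneg (hg0 y) ht1'.le,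
        ← ENNReal.ofReal_mul (rpow_nonneg (hg0 x) _)]
      exact ENNReal.ofReal_le_ofReal (hglc x y t ⟨ht0, ht1⟩)
    · simp [indicator_of_notMem hy, ht1]
  · simp [indicator_of_notMem hx, ht0]

/-- A form of Borell's inequality: a concavity property of the tail `s ↦ P(Y > s)`. -/
def HasBorellTail {Ω : Type*} [MeasurableSpace Ω] (P : Measure Ω) (Y : Ω → ℝ) : Prop :=
  ∀ t ∈ Ioo (0 : ℝ) 1, ∀ s r : ℝ,
    P.real {ω | s < Y ω} ^ t * P.real {ω | Y ω ≤ r} ^ (1 - t) ≤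
      P.real {ω | t * s - (1 - t) * r < Y ω}

theorem IsLogConcaveMeasure.hasBorellTail_norm_div {d : ℕ} {μ : Measure (EucSp d)}
    [IsProbabilityMeasure μ] (hμ : IsLogConcaveMeasure μ) {m : ℝ} (hm : 0 < m) :
    HasBorellTail μ fun x => ‖x‖ / m := by
  rintro t ⟨ht0, ht1⟩ s r
  have ht1' : 0 < 1 - t := sub_pos.2 ht1
  have key := hμ.measure_rpow_mul_measure_rpow_le ht0 ht1 (A := {x | s < ‖x‖ / m})
    (B := {x | ‖x‖ / m ≤ r}) (C := {x | t * s - (1 - t) * r < ‖x‖ / m})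
    (measurableSet_lt (by fun_prop) (by fun_prop)) (measurableSet_le (by fun_prop) (by fun_prop))
    (measurableSet_lt (by fun_prop) (by fun_prop)) (by
      intro x hx y hy
      simp only [mem_ofPred_eq, lt_div_iff₀ hm, div_le_iff₀ hm] at hx hy ⊢
      have h1 : ‖t • x‖ ≤ ‖t • x + (1 - t) • y‖ + ‖(1 - t) • y‖ := by
        simpa using norm_sub_le (t • x + (1 - t) • y) ((1 - t) • y)
      rw [norm_smul, norm_smul, norm_of_nonneg ht0.le, norm_of_nonneg ht1'.le] at h1
      have h2 := mul_lt_mul_of_pos_left hx ht0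
      have h3 := mul_le_mul_of_nonneg_left hy ht1'.le
      linarith)
  have := ENNReal.toReal_mono (measure_ne_top _ _) key
  rwa [ENNReal.toReal_mul, ← ENNReal.toReal_rpow, ← ENNReal.toReal_rpow] at this

/-! ### Moments of variables with a Borell tail -/

theorem mul_log_add_sub_le_mul_log {k c : ℝ} (hk : 0 < k) (hc : 0 < c) :
    k * log c + k - c ≤ k * log k := by
  have h := log_le_sub_one_of_pos (div_pos hc hk)
  rw [log_div hc.ne' hk.ne'] at h
  have := mul_le_mul_of_nonneg_left h hk.le
  have e : k * (c / k - 1) = c - k := by field_simp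
  linarith

theorem sixteen_rpow_sub_one_le {k : ℝ} (hk : 1 ≤ k) (hk2 : k ≤ 2) :
    (16 : ℝ) ^ (k - 1) ≤ (2 * k) ^ k := by
  have hk0 : 0 < k := by linarith
  rw [rpow_def_of_pos (by norm_num), rpow_def_of_pos (by positivity), exp_le_exp,
    log_mul two_ne_zero hk0.ne', show (16 : ℝ) = 2 ^ (4 : ℕ) by norm_num, log_pow]
  have h := mul_log_add_sub_le_mul_log hk0 two_pos
  have h2 := log_two_gt_d9
  push_cast
  nlinarith

theorem four_rpow_sub_one_le {k : ℝ} (hk : 2 ≤ k) : (4 : ℝ) ^ (k - 1) ≤ k ^ k := by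
  have hk0 : 0 < k := by linarith
  rw [rpow_def_of_pos (by norm_num), rpow_def_of_pos hk0, exp_le_exp,
    show (4 : ℝ) = 2 ^ (2 : ℕ) by norm_num, log_pow]
  have h := mul_log_add_sub_le_mul_log hk0 two_pos
  have h2 := log_two_lt_d9
  push_cast
  nlinarith

theorem two_mul_three_rpow_le {θ : ℝ} (h0 : 0 ≤ θ) (h1 : θ ≤ 1) :
    2 * (3 : ℝ) ^ θ ≤ 54 / 25 * ((θ + 2) / 2) ^ (θ + 2) := by
  set a : ℝ := (θ + 2) / 2 with ha
  have ha0 : 0 < a := by positivity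
  have e : (3 : ℝ) ^ θ = 2 ^ θ * (3 / (2 * a)) ^ θ * a ^ θ := by
    rw [← mul_rpow (by positivity) (by positivity), ← mul_rpow (by positivity) (by positivity)]
    congr 1
    field_simp
  have b1 : (2 : ℝ) ^ θ ≤ 1 + θ := by
    have := rpow_one_add_le_one_add_mul_self (s := 1) (by norm_num) h0 h1
    norm_num at this
    linarith
  have b2 : (3 / (2 * a)) ^ θ ≤ 1 + θ * (3 / (2 * a) - 1) := by
    have := rpow_one_add_le_one_add_mul_self (s := 3 / (2 * a) - 1)
      (by have : 0 < 3 / (2 * a) := by positivity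
          linarith) h0 h1
    simpa using this
  have b3 : 1 + θ * (3 / (2 * a) - 1) = (1 + θ - θ ^ 2 / 2) / a := by
    rw [ha]; field_simp; ring
  rw [e, rpow_add ha0, rpow_two]
  have hpoly : (1 + θ) * ((1 + θ - θ ^ 2 / 2) / a) ≤ 27 / 25 * a ^ 2 := by
    rw [← mul_div_assoc, div_le_iff₀ ha0, ha]
    nlinarith [mul_nonneg h0 (sq_nonneg (θ - 8 / 25)), sq_nonneg (θ - 8 / 25)]
  have b4 : (2 : ℝ) ^ θ * (3 / (2 * a)) ^ θ ≤ 27 / 25 * a ^ 2 :=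
    (mul_le_mul b1 (b2.trans_eq b3) (by positivity) (by linarith)).trans hpoly
  nlinarith [mul_le_mul_of_nonneg_right b4 (rpow_nonneg ha0.le θ)]

theorem Gamma_add_one_le_base {k : ℝ} (hk2 : 2 ≤ k) (hk3 : k ≤ 3) :
    Gamma (k + 1) ≤ 54 / 25 * (k / 2) ^ k := by
  have G3 : Gamma 3 = 2 := by
    rw [show (3 : ℝ) = (2 : ℕ) + 1 by norm_num, Gamma_nat_eq_factorial]
    norm_num [Nat.factorial]
  have G4 : Gamma 4 = 6 := by
    rw [show (4 : ℝ) = (3 : ℕ) + 1 by norm_num, Gamma_nat_eq_factorial]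
    norm_num [Nat.factorial]
  have main : Gamma (k + 1) ≤ 2 * (3 : ℝ) ^ (k - 2) := by
    rcases hk2.eq_or_lt with rfl | hk2
    · norm_num [G3]
    rcases hk3.eq_or_lt with rfl | hk3
    · norm_num [G4]
    have := Gamma_mul_add_mul_le_rpow_Gamma_mul_rpow_Gamma (s := 3) (t := 4) (a := 3 - k)
      (b := k - 2) (by norm_num) (by norm_num) (by linarith) (by linarith) (by ring)
    rw [G3, G4, show (6 : ℝ) = 2 * 3 by norm_num, mul_rpow (by norm_num) (by norm_num),
      ← mul_assoc, ← rpow_add two_pos] at this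
    convert this using 2
    · ring
    · rw [show 3 - k + (k - 2) = 1 by ring, rpow_one]
  refine main.trans ?_
  simpa using two_mul_three_rpow_le (θ := k - 2) (by linarith) (by linarith)

theorem Gamma_add_one_le {k : ℝ} (hk : 2 ≤ k) : Gamma (k + 1) ≤ 54 / 25 * (k / 2) ^ k := by
  have main : ∀ n : ℕ, ∀ k : ℝ, 2 ≤ k → k ≤ 3 + n →
      Gamma (k + 1) ≤ 54 / 25 * (k / 2) ^ k := by
    intro n
    induction n with
    | zero => exact fun k h2 h3 => Gamma_add_one_le_base h2 (by simpa using h3)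
    | succ n ih =>
      intro k h2 h3
      rcases le_total k 3 with h | h
      · exact Gamma_add_one_le_base h2 h
      push_cast at h3
      obtain ⟨j, rfl⟩ : ∃ j, k = j + 1 := ⟨k - 1, by ring⟩
      have hj : 0 < j := by linarith
      have hb : (2 : ℝ) ≤ (1 + 1 / j) ^ j := by
        have := one_add_mul_self_le_rpow_one_add (s := 1 / j)
          (by have : 0 < 1 / j := by positivity
              linarith) (p := j) (by linarith)
        rw [mul_one_div_cancel hj.ne'] at this
        linarith
      have hb' : 2 * (j / 2) ^ j ≤ ((j + 1) / 2) ^ j := by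
        rw [show (j + 1) / 2 = (1 + 1 / j) * (j / 2) by field_simp,
          mul_rpow (by positivity) (by positivity)]
        gcongr
      rw [Gamma_add_one (by linarith)]
      calc (j + 1) * Gamma (j + 1) ≤ (j + 1) * (54 / 25 * (j / 2) ^ j) := by
            gcongr
            exact ih j (by linarith) (by linarith)
        _ ≤ 54 / 25 * (((j + 1) / 2) ^ j * ((j + 1) / 2)) := by nlinarith
        _ = _ := by rw [rpow_add_one (by positivity)]
  obtain ⟨n, hn⟩ := exists_nat_ge k
  exact main n k hk (by linarith)

theorem moment_bound_le {k : ℝ} (hk : 2 ≤ k) :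
    (16 / 3 : ℝ) ^ (k - 1) + exp (-(3 / 8)) * ((8 / 3) ^ k * Gamma (k + 1)) ≤ (2 * k) ^ k := by
  have hk0 : 0 < k := by linarith
  have he : exp (-(3 / 8)) ≤ 11 / 16 := by
    rw [exp_neg, inv_le_comm₀ (exp_pos _) (by norm_num)]
    have h8 : exp (3 / 8) ^ 8 = exp 1 ^ 3 := by
      rw [← exp_nat_mul, ← exp_nat_mul]; norm_num
    refine le_of_pow_le_pow_left₀ (n := 8) (by norm_num) (exp_pos _).le ?_
    rw [h8]
    calc _ ≤ (2.7182818283 : ℝ) ^ 3 := by norm_num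
      _ ≤ _ := by gcongr; exact exp_one_gt_d9.le
  have hQ : 0 < (4 * k / 3) ^ k := by positivity
  have h1 : (16 / 3 : ℝ) ^ (k - 1) ≤ 3 / 4 * (4 * k / 3) ^ k := by
    have e1 : (4 * k / 3) ^ k = (4 / 3) * ((4 / 3) ^ (k - 1) * k ^ k) := by
      rw [show 4 * k / 3 = 4 / 3 * k by ring, mul_rpow (by norm_num) hk0.le, ← mul_assoc]
      congr 1
      rw [rpow_sub_one (by norm_num)]
      field_simp
    rw [e1, show (16 / 3 : ℝ) = 4 / 3 * 4 by norm_num, mul_rpow (by norm_num) (by norm_num)]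
    have := mul_le_mul_of_nonneg_left (four_rpow_sub_one_le hk)
      (rpow_nonneg (show (0 : ℝ) ≤ 4 / 3 by norm_num) (k - 1))
    linarith
  have h2 : exp (-(3 / 8)) * ((8 / 3) ^ k * Gamma (k + 1)) ≤ 3 / 2 * (4 * k / 3) ^ k - 3 / 200 *
      (4 * k / 3) ^ k := by
    calc _ ≤ 11 / 16 * ((8 / 3) ^ k * (54 / 25 * (k / 2) ^ k)) := by
          gcongr
          exact Gamma_add_one_le hk
      _ = 297 / 200 * ((8 / 3) ^ k * (k / 2) ^ k) := by ring
      _ = _ := by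
          rw [← mul_rpow (by norm_num) (by positivity),
            show (8 / 3 : ℝ) * (k / 2) = 4 * k / 3 by ring]
          ring
  have h3 : (9 / 4 : ℝ) * (4 * k / 3) ^ k ≤ (2 * k) ^ k := by
    rw [show 2 * k = 3 / 2 * (4 * k / 3) by ring, mul_rpow (by norm_num) (by positivity)]
    gcongr
    calc (9 / 4 : ℝ) = (3 / 2) ^ (2 : ℝ) := by rw [rpow_two]; norm_num
      _ ≤ _ := rpow_le_rpow_of_exponent_le (by norm_num) hk
  linarith

section BorellTail

variable {Ω : Type*} [MeasurableSpace Ω] {P : Measure Ω} [IsProbabilityMeasure P] {Y : Ω → ℝ}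

theorem integral_exp_window :
    1 < ∫ t in (0 : ℝ)..13 / 3, exp (-(3 / 8) * (t + 2)) := by
  have h : ∀ t ∈ uIcc (0 : ℝ) (13 / 3),
      HasDerivAt (fun t => -(8 / 3) * exp (-(3 / 8) * (t + 2))) (exp (-(3 / 8) * (t + 2))) t := by
    intro t _
    have h1 : HasDerivAt (fun t : ℝ => -(3 / 8) * (t + 2)) (-(3 / 8) * 1) t :=
      ((hasDerivAt_id t).add_const 2).const_mul _
    exact (h1.exp.const_mul (-(8 / 3) : ℝ)).congr_deriv (by ring)
  rw [intervalIntegral.integral_eq_sub_of_hasDerivAt h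
    (Continuous.intervalIntegrable (by fun_prop) _ _)]
  have h1 : exp (-(3 / 8) * (13 / 3 + 2)) ≤ 94 / 1000 := by
    refine le_of_pow_le_pow_left₀ (n := 8) (by norm_num) (by norm_num) ?_
    rw [← exp_nat_mul, show ((8 : ℕ) : ℝ) * (-(3 / 8) * (13 / 3 + 2)) = -((19 : ℕ) * 1) by norm_num,
      exp_neg, exp_nat_mul, inv_le_comm₀ (by positivity) (by norm_num)]
    calc _ ≤ (2.7182818283 : ℝ) ^ 19 := by norm_num
      _ ≤ _ := by gcongr; exact exp_one_gt_d9.le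
  have h2 : 472 / 1000 ≤ exp (-(3 / 8) * (0 + 2)) := by
    refine le_of_pow_le_pow_left₀ (n := 4) (by norm_num) (exp_pos _).le ?_
    rw [← exp_nat_mul, show ((4 : ℕ) : ℝ) * (-(3 / 8) * (0 + 2)) = -((3 : ℕ) * 1) by norm_num,
      exp_neg, exp_nat_mul, le_inv_comm₀ (by norm_num) (by positivity)]
    calc _ ≤ (2.7182818286 : ℝ) ^ 3 := by gcongr; exact exp_one_lt_d9.le
      _ ≤ _ := by norm_num
  linarith

theorem lintegral_posPart_sub_one_le (hY : Integrable Y P) (hY0 : ∀ ω, 0 ≤ Y ω)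
    (hY1 : ∫ ω, Y ω ∂P = 1) :
    ∫⁻ ω, ENNReal.ofReal (max (Y ω - 1) 0) ∂P ≤ P {ω | Y ω ≤ 1} := by
  have hi1 : Integrable (fun ω => max (Y ω - 1) 0) P := (hY.sub (integrable_const 1)).pos_part
  have hi2 : Integrable (fun ω => max (1 - Y ω) 0) P :=
    ((integrable_const 1).sub hY).pos_part
  have e : ∫ ω, max (Y ω - 1) 0 ∂P = ∫ ω, max (1 - Y ω) 0 ∂P := by
    rw [← sub_eq_zero, ← integral_sub hi1 hi2]
    have : ∀ ω, max (Y ω - 1) 0 - max (1 - Y ω) 0 = Y ω - 1 := by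
      intro ω
      rcases le_total (Y ω) 1 with h | h
      · rw [max_eq_right (by linarith), max_eq_left (by linarith)]; ring
      · rw [max_eq_left (by linarith), max_eq_right (by linarith)]; ring
    simp [this, integral_sub hY (integrable_const 1), hY1]
  rw [← ofReal_integral_eq_lintegral_ofReal hi1 (ae_of_all _ fun ω => le_max_right _ _), e,
    ofReal_integral_eq_lintegral_ofReal hi2 (ae_of_all _ fun ω => le_max_right _ _)]
  refine (lintegral_mono fun ω => ?_).trans (lintegral_indicator_one_le {ω | Y ω ≤ 1})
  by_cases h : Y ω ≤ 1
  · rw [indicator_of_mem (show ω ∈ {ω | Y ω ≤ 1} from h)]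
    exact ENNReal.ofReal_le_one.2 (max_le (by linarith [hY0 ω]) zero_le_one)
  · rw [max_eq_right (by linarith)]
    simp

theorem exists_tail_le (hY : Integrable Y P) (hYm : Measurable Y) (hY0 : ∀ ω, 0 ≤ Y ω)
    (hY1 : ∫ ω, Y ω ∂P = 1) :
    ∃ s ∈ Icc (1 : ℝ) (16 / 3), P.real {ω | s < Y ω} ≤
      P.real {ω | Y ω ≤ 1} * exp (-(3 / 8) * (s + 1)) := by
  by_contra! hcon
  set b := P.real {ω | Y ω ≤ 1} with hb
  have hbpos : 0 < b := by
    have := measure_le_integral_pos hY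
    rw [hY1] at this
    exact ENNReal.toReal_pos this.ne' (measure_ne_top _ _)
  have key := lintegral_posPart_sub_one_le hY hY0 hY1
  rw [lintegral_eq_lintegral_meas_lt (f := fun ω => max (Y ω - 1) 0) _
    (ae_of_all _ fun ω => le_max_right _ _) (by fun_prop), ← ofReal_measureReal] at key
  have hcont : Continuous fun t : ℝ => b * exp (-(3 / 8) * (t + 2)) := by fun_prop
  have low : ENNReal.ofReal (∫ t in (0 : ℝ)..13 / 3, b * exp (-(3 / 8) * (t + 2))) ≤
      ∫⁻ t in Ioi (0 : ℝ), P {ω | t < max (Y ω - 1) 0} := by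
    rw [intervalIntegral.integral_of_le (by norm_num), ofReal_integral_eq_lintegral_ofReal
      (hcont.integrableOn_Ioc) (ae_of_all _ fun t => by positivity)]
    refine le_trans (setLIntegral_mono' measurableSet_Ioc fun t ht => ?_)
      (lintegral_mono_set Ioc_subset_Ioi_self)
    have h1 := (hcon (t + 1) ⟨by linarith [ht.1], by linarith [ht.2]⟩).le
    rw [show t + 1 + 1 = t + 2 by ring] at h1
    refine (ENNReal.ofReal_le_ofReal h1).trans ?_
    rw [ofReal_measureReal]
    refine measure_mono fun ω hω => ?_
    have hω' : t + 1 < Y ω := hω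
    exact lt_max_of_lt_left (show t < Y ω - 1 by linarith)
  have h2 := (ENNReal.ofReal_le_ofReal_iff hbpos.le).1 (low.trans key)
  rw [intervalIntegral.integral_const_mul] at h2
  nlinarith [integral_exp_window]

theorem HasBorellTail.tail_le (hB : HasBorellTail P Y) (hY : Integrable Y P) (hYm : Measurable Y)
    (hY0 : ∀ ω, 0 ≤ Y ω) (hY1 : ∫ ω, Y ω ∂P = 1) {u : ℝ} (hu : 16 / 3 ≤ u) :
    P.real {ω | u < Y ω} ≤ exp (-(3 / 8) * (u + 1)) := by
  obtain ⟨s, ⟨hs1, hs2⟩, hs⟩ := exists_tail_le hY hYm hY0 hY1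
  set b := P.real {ω | Y ω ≤ 1} with hb
  have hb1 : b ≤ 1 := measureReal_le_one
  have hbpos : 0 < b := by
    have := measure_le_integral_pos hY
    rw [hY1] at this
    exact ENNReal.toReal_pos this.ne' (measure_ne_top _ _)
  suffices h : P.real {ω | u < Y ω} ≤ b * exp (-(3 / 8) * (u + 1)) from
    h.trans (mul_le_of_le_one_left (exp_pos _).le hb1)
  rcases (hs2.trans hu).eq_or_lt with rfl | hsu
  · exact hs
  set t := (s + 1) / (u + 1) with ht
  have hu1 : 0 < u + 1 := by linarith
  have ht0 : 0 < t := div_pos (by linarith) hu1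
  have ht1 : t < 1 := (div_lt_one hu1).2 (by linarith)
  have htu : t * (u + 1) = s + 1 := div_mul_cancel₀ _ hu1.ne'
  have h1 := hB t ⟨ht0, ht1⟩ u 1
  rw [show t * u - (1 - t) * 1 = s by linarith] at h1
  refine (rpow_le_rpow_iff measureReal_nonneg (by positivity) ht0).1 ?_
  have hb' : 0 < b ^ (1 - t) := by positivity
  refine le_of_mul_le_mul_right ((h1.trans hs).trans_eq ?_) hb'
  rw [mul_rpow hbpos.le (exp_pos _).le, ← exp_mul, mul_right_comm, ← rpow_add hbpos]
  rw [show t + (1 - t) = 1 by ring, rpow_one, mul_assoc, mul_comm (u + 1), htu]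

theorem HasBorellTail.lintegral_max_rpow_le (hB : HasBorellTail P Y) (hY : Integrable Y P)
    (hYm : Measurable Y) (hY0 : ∀ ω, 0 ≤ Y ω) (hY1 : ∫ ω, Y ω ∂P = 1) {k : ℝ} (hk : 1 ≤ k) :
    ∫⁻ ω, ENNReal.ofReal (max (Y ω) (16 / 3) ^ k) ∂P ≤
      ENNReal.ofReal ((16 / 3) ^ k + exp (-(3 / 8)) * ((8 / 3) ^ k * Gamma (k + 1))) := by
  have hk0 : 0 < k := by linarith
  have hG : 0 < Gamma k := Gamma_pos_of_pos hk0
  rw [lintegral_rpow_eq_lintegral_meas_lt_mul _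
    (ae_of_all _ fun ω => (hY0 ω).trans (le_max_left _ _)) (by fun_prop) hk0]
  have bound : ∀ t ∈ Ioi (0 : ℝ), P {ω | t < max (Y ω) (16 / 3)} * ENNReal.ofReal (t ^ (k - 1)) ≤
      (Iio (16 / 3 : ℝ)).indicator (fun t => ENNReal.ofReal (t ^ (k - 1))) t +
        ENNReal.ofReal (exp (-(3 / 8)) * (t ^ (k - 1) * exp (-(3 / 8 * t)))) := by
    intro t ht
    have ht0 : 0 < t := ht
    rcases lt_or_ge t (16 / 3) with h | h
    · rw [indicator_of_mem (show t ∈ Iio (16 / 3 : ℝ) from h)]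
      exact le_add_right (mul_le_of_le_one_left zero_le prob_le_one)
    · rw [indicator_of_notMem (show t ∉ Iio (16 / 3 : ℝ) from not_lt.2 h), zero_add]
      have e : {ω | t < max (Y ω) (16 / 3)} = {ω | t < Y ω} := by
        ext ω
        simp [not_lt.2 h]
      rw [e, ← ofReal_measureReal, ← ENNReal.ofReal_mul measureReal_nonneg]
      refine ENNReal.ofReal_le_ofReal ?_
      have h1 := hB.tail_le hY hYm hY0 hY1 h
      rw [show -(3 / 8) * (t + 1) = -(3 / 8) + -(3 / 8 * t) by ring, exp_add] at h1
      calc _ ≤ exp (-(3 / 8)) * exp (-(3 / 8 * t)) * t ^ (k - 1) := by gcongr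
        _ = _ := by ring
  have I1 : ∫⁻ t in Ioi (0 : ℝ), (Iio (16 / 3 : ℝ)).indicator
      (fun t => ENNReal.ofReal (t ^ (k - 1))) t = ENNReal.ofReal ((16 / 3) ^ k / k) := by
    rw [lintegral_indicator measurableSet_Iio, Measure.restrict_restrict measurableSet_Iio,
      Iio_inter_Ioi, setLIntegral_congr Ioo_ae_eq_Ioc, ← ofReal_integral_eq_lintegral_ofReal,
      ← intervalIntegral.integral_of_le (by norm_num), integral_rpow (by left; linarith)]
    · simp [hk0.ne']
    · exact (intervalIntegrable_iff_integrableOn_Ioc_of_le (by norm_num)).1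
        (intervalIntegral.intervalIntegrable_rpow' (by linarith))
    · filter_upwards [ae_restrict_mem measurableSet_Ioc] with t ht
      exact rpow_nonneg ht.1.le _
  have hGI : ∫ t in Ioi (0 : ℝ), t ^ (k - 1) * exp (-(3 / 8 * t)) = (8 / 3) ^ k * Gamma k := by
    rw [integral_rpow_mul_exp_neg_mul_Ioi hk0 (by norm_num)]
    norm_num
  have I2 : ∫⁻ t in Ioi (0 : ℝ), ENNReal.ofReal
      (exp (-(3 / 8)) * (t ^ (k - 1) * exp (-(3 / 8 * t)))) =
      ENNReal.ofReal (exp (-(3 / 8)) * ((8 / 3) ^ k * Gamma k)) := by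
    rw [← ofReal_integral_eq_lintegral_ofReal, integral_const_mul, hGI]
    · refine Integrable.const_mul (Integrable.of_integral_ne_zero ?_) _
      rw [hGI]
      positivity
    · filter_upwards [ae_restrict_mem measurableSet_Ioi] with t ht
      have ht0 : 0 < t := ht
      positivity
  refine (mul_le_mul_right (setLIntegral_mono' measurableSet_Ioi bound) _).trans_eq ?_
  rw [lintegral_add_left (Measurable.indicator (by fun_prop) measurableSet_Iio), I1, I2,
    ← ENNReal.ofReal_add (by positivity) (by positivity), ← ENNReal.ofReal_mul hk0.le,
    Gamma_add_one hk0.ne']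
  congr 1
  field_simp

theorem HasBorellTail.integral_rpow_le_of_two_le (hB : HasBorellTail P Y) (hY : Integrable Y P)
    (hYm : Measurable Y) (hY0 : ∀ ω, 0 ≤ Y ω) (hY1 : ∫ ω, Y ω ∂P = 1) {k : ℝ} (hk : 2 ≤ k)
    (hYk : Integrable (fun ω => Y ω ^ k) P) :
    ∫ ω, Y ω ^ k ∂P ≤ (2 * k) ^ k := by
  have hk0 : 0 < k := by linarith
  have hZ0 : ∀ ω, 0 ≤ max (Y ω) (16 / 3) := fun ω => (hY0 ω).trans (le_max_left _ _)
  have hZi : Integrable (fun ω => max (Y ω) (16 / 3) ^ k) P := by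
    refine (hYk.add (integrable_const ((16 / 3 : ℝ) ^ k))).mono'
      ((hYm.max measurable_const).pow_const k).aestronglyMeasurable (ae_of_all _ fun ω => ?_)
    rw [norm_of_nonneg (rpow_nonneg (hZ0 ω) _)]
    have := rpow_nonneg (hY0 ω) k
    have : 0 ≤ (16 / 3 : ℝ) ^ k := by positivity
    rcases le_total (Y ω) (16 / 3) with h | h
    · simpa [max_eq_right h]
    · simpa [max_eq_left h]
  have hZ := hB.lintegral_max_rpow_le hY hYm hY0 hY1 (show 1 ≤ k by linarith)
  have hG : 0 < Gamma (k + 1) := Gamma_pos_of_pos (by linarith)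
  rw [← ofReal_integral_eq_lintegral_ofReal hZi (ae_of_all _ fun ω => rpow_nonneg (hZ0 ω) _),
    ENNReal.ofReal_le_ofReal_iff (by positivity)] at hZ
  have hpt : ∀ ω, Y ω ^ k ≤
      (16 / 3) ^ (k - 1) * Y ω + (max (Y ω) (16 / 3) ^ k - (16 / 3) ^ k) := by
    intro ω
    rcases le_total (Y ω) (16 / 3) with h | h
    · rw [max_eq_right h, sub_self, add_zero]
      rcases (hY0 ω).eq_or_lt with h0 | h0
      · simp [← h0, hk0.ne']
      · rw [← sub_add_cancel k 1, rpow_add_one h0.ne', add_sub_cancel_right]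
        gcongr
        linarith
    · rw [max_eq_left h]
      have : (16 / 3 : ℝ) ^ k = (16 / 3) ^ (k - 1) * (16 / 3) := by
        rw [← rpow_add_one (by norm_num), sub_add_cancel]
      rw [this]
      nlinarith [rpow_nonneg (show (0 : ℝ) ≤ 16 / 3 by norm_num) (k - 1)]
  have hW : Integrable (fun ω => max (Y ω) (16 / 3) ^ k - (16 / 3 : ℝ) ^ k) P :=
    hZi.sub (integrable_const _)
  have hint := integral_mono hYk ((hY.const_mul ((16 / 3 : ℝ) ^ (k - 1))).add hW) hpt
  simp only [Pi.add_apply] at hint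
  rw [integral_add (hY.const_mul _) hW,
    integral_sub hZi (integrable_const _), integral_const_mul, hY1, integral_const] at hint
  simp only [probReal_univ, one_smul, mul_one] at hint
  linarith [moment_bound_le hk]

theorem HasBorellTail.integral_rpow_le (hB : HasBorellTail P Y) (hY : Integrable Y P)
    (hYm : Measurable Y) (hY0 : ∀ ω, 0 ≤ Y ω) (hY1 : ∫ ω, Y ω ∂P = 1) {k : ℝ} (hk : 1 ≤ k)
    (hY2 : Integrable (fun ω => Y ω ^ (2 : ℝ)) P) (hYk : Integrable (fun ω => Y ω ^ k) P) :
    ∫ ω, Y ω ^ k ∂P ≤ (2 * k) ^ k := by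
  rcases le_total 2 k with hk2 | hk2
  · exact hB.integral_rpow_le_of_two_le hY hYm hY0 hY1 hk2 hYk
  have h16 : ∫ ω, Y ω ^ (2 : ℝ) ∂P ≤ 16 := by
    refine (hB.integral_rpow_le_of_two_le hY hYm hY0 hY1 le_rfl hY2).trans_eq ?_
    rw [rpow_two]; norm_num
  have hpt : ∀ ω, Y ω ^ k ≤
      16 ^ (k - 1) * ((2 - k) * Y ω + (k - 1) / 16 * Y ω ^ (2 : ℝ)) := by
    intro ω
    rcases (hY0 ω).eq_or_lt with h0 | h0
    · simp [← h0, show k ≠ 0 by linarith]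
    have h1 := rpow_one_add_le_one_add_mul_self (s := Y ω / 16 - 1)
      (by have : 0 < Y ω / 16 := by positivity
          linarith) (p := k - 1) (by linarith) (by linarith)
    rw [add_sub_cancel, div_rpow h0.le (by norm_num), div_le_iff₀ (by positivity)] at h1
    calc Y ω ^ k = Y ω ^ (k - 1) * Y ω := by rw [← rpow_add_one h0.ne', sub_add_cancel]
      _ ≤ (1 + (k - 1) * (Y ω / 16 - 1)) * 16 ^ (k - 1) * Y ω := by gcongr
      _ = _ := by rw [rpow_two]; ring
  have hint := integral_mono hYk
    (((hY.const_mul (2 - k)).add (hY2.const_mul ((k - 1) / 16))).const_mul (16 ^ (k - 1))) hpt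
  simp only [Pi.add_apply] at hint
  rw [integral_const_mul, integral_add (hY.const_mul _) (hY2.const_mul _), integral_const_mul,
    integral_const_mul, hY1] at hint
  refine hint.trans (le_trans ?_ (sixteen_rpow_sub_one_le hk hk2))
  refine mul_le_of_le_one_right (by positivity) ?_
  have := mul_le_mul_of_nonneg_left h16 (show 0 ≤ (k - 1) / 16 by linarith)
  linarith

end BorellTail

/-- **Theorem (Statement 10, Lovász–Vempala).** Reverse Hölder inequality for log-concave
vectors: if `X` has a log-concave distribution on `ℝ^d`, then for every `k ≥ 1`,
`E[‖X‖^k]^{1/k} ≤ 2k·E[‖X‖] ≤ 2k·E[‖X‖²]^{1/2}`. -/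
theorem lovasz_vempala_reverse_holder {d : ℕ}
    (μ : Measure (EucSp d)) [IsProbabilityMeasure μ]
    (hlc : IsLogConcaveMeasure μ)
    (k : ℝ) (hk : 1 ≤ k)
    -- all indicated moments are assumed finite
    (h1 : Integrable (fun x => ‖x‖) μ)
    (h2 : Integrable (fun x => ‖x‖ ^ (2:ℝ)) μ)
    (hkInt : Integrable (fun x => ‖x‖ ^ k) μ) :
    (∫ x, ‖x‖ ^ k ∂μ) ^ (1 / k) ≤ 2 * k * ∫ x, ‖x‖ ∂μ ∧
      2 * k * (∫ x, ‖x‖ ∂μ) ≤ 2 * k * (∫ x, ‖x‖ ^ (2:ℝ) ∂μ) ^ ((1:ℝ) / 2) := by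
  have hm0 : 0 ≤ ∫ x, ‖x‖ ∂μ := integral_nonneg fun x => norm_nonneg x
  have hk0 : 0 < k := by linarith
  have hr0 : ∀ r : ℝ, 0 ≤ ∫ x, ‖x‖ ^ r ∂μ :=
    fun r => integral_nonneg fun x => rpow_nonneg (norm_nonneg x) r
  set m := ∫ x, ‖x‖ ∂μ with hm
  refine ⟨?_, ?_⟩
  · suffices h : ∫ x, ‖x‖ ^ k ∂μ ≤ (2 * k * m) ^ k by
      rw [one_div]
      exact (rpow_inv_le_iff_of_pos (hr0 k) (by positivity) hk0).2 h
    rcases hm0.eq_or_lt with h0 | hmpos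
    · have hae := (integral_eq_zero_iff_of_nonneg (fun x => norm_nonneg x) h1).1 (hm ▸ h0.symm)
      have : (fun x : EucSp d => ‖x‖ ^ k) =ᵐ[μ] fun _ => 0 := by
        filter_upwards [hae] with x hx
        simp [show ‖x‖ = 0 from hx, hk0.ne']
      rw [integral_congr_ae this]
      simp only [integral_zero]
      positivity
    have hpow : ∀ r : ℝ, (fun x : EucSp d => (‖x‖ / m) ^ r) = fun x => ‖x‖ ^ r / m ^ r :=
      fun r => funext fun x => div_rpow (norm_nonneg x) hm0 r
    have key := (hlc.hasBorellTail_norm_div hmpos).integral_rpow_le (h1.div_const m) (by fun_prop)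
      (fun x => div_nonneg (norm_nonneg x) hm0) (by rw [integral_div, ← hm, div_self hmpos.ne'])
      hk (by rw [hpow]; exact h2.div_const _) (by rw [hpow]; exact hkInt.div_const _)
    rw [hpow, integral_div, div_le_iff₀ (by positivity)] at key
    rwa [mul_rpow (by positivity) hm0]
  · refine mul_le_mul_of_nonneg_left ?_ (by positivity)
    rw [← sqrt_eq_rpow]
    refine le_sqrt_of_sq_le ?_
    have hsub : Integrable (fun x => ‖x‖ ^ (2 : ℝ) - 2 * m * ‖x‖) μ := h2.sub (h1.const_mul _)
    have hvar : 0 ≤ ∫ x, (‖x‖ ^ (2 : ℝ) - 2 * m * ‖x‖ + m ^ 2) ∂μ :=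
      integral_nonneg fun x => by
        simp only [rpow_two, Pi.zero_apply]
        nlinarith [sq_nonneg (‖x‖ - m)]
    rw [integral_add hsub (integrable_const _), integral_sub h2 (h1.const_mul _), integral_const_mul, ← hm, integral_const] at hvar
    simp only [probReal_univ, one_smul] at hvar
    linarith
end
end

section
/- k-th moment bound for perturbed standardization: let U be a random vector in ℝ^d whose distribution is log-concave, let H = E[(U − E[U])(U − E[U])ᵀ]^{1/2} be the symmetric square root of its covariance matrix (assumed invertible), and let J be an invertible d×d matrix with ‖I_d − H^{-1}J‖ < 1/2 in operator norm. Set V = J^{-1}(U − E[U]). Then for every k ≥ 1, sup_{‖a‖=1} E[ |⟨a, V⟩|^k ] ≤ 2^{2k}·k^k. -/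
open MeasureTheory Filter Real Set
open scoped ENNReal RealInnerProductSpace BigOperators

noncomputable section

/-- Weighted arithmetic-geometric mean inequality for extended nonnegative reals. -/
lemma ennreal_geom_mean_le_arith_mean {p q : ℝ} (hp : 0 < p) (hq : 0 < q) (hpq : p + q = 1)
    (a b : ℝ≥0∞) : a ^ p * b ^ q ≤ ENNReal.ofReal p * a + ENNReal.ofReal q * b := by
  have hc : (p⁻¹).HolderConjugate q⁻¹ :=
    Real.holderConjugate_iff.2 ⟨(one_lt_inv₀ hp).2 (by linarith), by simpa using hpq⟩
  have h := ENNReal.young_inequality (a ^ p) (b ^ q) hc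
  rwa [← ENNReal.rpow_mul, ← ENNReal.rpow_mul, mul_inv_cancel₀ hp.ne', mul_inv_cancel₀ hq.ne',
    ENNReal.rpow_one, ENNReal.rpow_one, ENNReal.ofReal_inv_of_pos hp, ENNReal.ofReal_inv_of_pos hq,
    div_eq_mul_inv, div_eq_mul_inv, inv_inv, inv_inv, mul_comm a, mul_comm b] at h

/-- One-dimensional Brunn-Minkowski inequality for compact sets. -/
lemma volume_add_le_of_isCompact {A B C : Set ℝ} (hA : IsCompact A) (hB : IsCompact B)
    (hA' : A.Nonempty) (hB' : B.Nonempty) (h : ∀ a ∈ A, ∀ b ∈ B, a + b ∈ C) :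
    volume A + volume B ≤ volume C := by
  obtain ⟨x, hxA, hx⟩ := hA.exists_isGreatest hA'
  obtain ⟨y, hyB, hy⟩ := hB.exists_isLeast hB'
  have hdisj : AEDisjoint volume ((· + y) '' A) ((x + ·) '' B) := by
    refine measure_mono_null (t := {x + y}) ?_ (by simp)
    rintro _ ⟨⟨a, ha, rfl⟩, b, hb, hab⟩
    have := hx ha
    have := hy hb
    simp only [mem_singleton_iff] at *
    linarith
  calc volume A + volume B = volume ((· + y) '' A) + volume ((x + ·) '' B) := by
        simp
    _ = volume ((· + y) '' A ∪ (x + ·) '' B) :=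
        (measure_union₀ (hB.image (by fun_prop)).measurableSet.nullMeasurableSet hdisj).symm
    _ ≤ volume C := measure_mono <| by
        rintro _ (⟨a, ha, rfl⟩ | ⟨b, hb, rfl⟩)
        exacts [h a ha y hyB, h x hxA b hb]

/-- One-dimensional Brunn-Minkowski inequality. -/
lemma volume_add_le {A B C : Set ℝ} (hA : MeasurableSet A) (hB : MeasurableSet B)
    (hA' : A.Nonempty) (hB' : B.Nonempty) (h : ∀ a ∈ A, ∀ b ∈ B, a + b ∈ C) :
    volume A + volume B ≤ volume C := by
  obtain ⟨a, ha⟩ := hA'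
  obtain ⟨b, hb⟩ := hB'
  rw [hA.measure_eq_iSup_isCompact, hB.measure_eq_iSup_isCompact]
  refine ENNReal.biSup_add_biSup_le' ⟨∅, empty_subset A⟩ ⟨∅, empty_subset B⟩ fun K hK L hL => ?_
  by_cases hKc : IsCompact K
  swap
  · simp only [hKc, iSup_false, bot_eq_zero, zero_add, iSup_le_iff]
    intro hLc
    refine le_trans ?_ (volume_add_le_of_isCompact (isCompact_singleton (x := a))
      (hLc.insert b) ⟨a, rfl⟩ ⟨b, mem_insert _ _⟩ fun u hu v hv => ?_)
    · exact (measure_mono (subset_insert _ _)).trans le_add_self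
    · rw [mem_singleton_iff.1 hu]
      exact h a ha v (insert_subset hb hL hv)
  by_cases hLc : IsCompact L
  swap
  · simp only [hLc, iSup_false, bot_eq_zero, add_zero, iSup_le_iff]
    intro hKc
    refine le_trans ?_ (volume_add_le_of_isCompact (hKc.insert a) (isCompact_singleton (x := b))
      ⟨a, mem_insert _ _⟩ ⟨b, rfl⟩ fun u hu v hv => ?_)
    · exact (measure_mono (subset_insert _ _)).trans le_self_add
    · rw [mem_singleton_iff.1 hv]
      exact h u (insert_subset ha hK hu) b hb
  simp only [hKc, hLc, iSup_true]
  refine le_trans (add_le_add (measure_mono (subset_insert a K)) (measure_mono (subset_insert b L)))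
    (volume_add_le_of_isCompact (hKc.insert a) (hLc.insert b) ⟨a, mem_insert _ _⟩
      ⟨b, mem_insert _ _⟩ fun u hu v hv =>
        h u (insert_subset ha hK hu) v (insert_subset hb hL hv))

/-- One-dimensional Brunn-Minkowski inequality for weighted Minkowski sums. -/
lemma weighted_volume_add_le {p q : ℝ} (hp : 0 < p) (hq : 0 < q) {A B C : Set ℝ}
    (hA : MeasurableSet A) (hB : MeasurableSet B) (hA' : A.Nonempty) (hB' : B.Nonempty)
    (h : ∀ a ∈ A, ∀ b ∈ B, p * a + q * b ∈ C) :
    ENNReal.ofReal p * volume A + ENNReal.ofReal q * volume B ≤ volume C := by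
  open scoped Pointwise in
  have := volume_add_le (hA.const_smul₀ p) (hB.const_smul₀ q) (hA'.smul_set (a := p))
    (hB'.smul_set (a := q)) (C := C) (by
      rintro _ ⟨a, ha, rfl⟩ _ ⟨b, hb, rfl⟩
      exact h a ha b hb)
  simpa [Measure.addHaar_smul, abs_of_pos hp, abs_of_pos hq] using this

lemma lintegral_eq_lintegral_Ioo_measure_lt {α : Type*} [MeasurableSpace α] {μ : Measure α}
    {f : α → ℝ≥0∞} (hf : Measurable f) (hf1 : ∀ x, f x ≤ 1) :
    ∫⁻ x, f x ∂μ = ∫⁻ c in Ioo (0 : ℝ) 1, μ {x | ENNReal.ofReal c < f x} := by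
  have hfin : ∀ x, f x ≠ ∞ := fun x => ne_top_of_le_ne_top ENNReal.one_ne_top (hf1 x)
  have h := lintegral_eq_lintegral_meas_lt μ (f := fun x => (f x).toReal)
    (Eventually.of_forall fun _ => ENNReal.toReal_nonneg) hf.ennreal_toReal.aemeasurable
  simp only [ENNReal.ofReal_toReal (hfin _)] at h
  rw [h, ← Ioo_union_Ici_eq_Ioi zero_lt_one, lintegral_union measurableSet_Ici (by
    rw [Set.disjoint_left]; intro x hx hx'; exact hx.2.not_ge hx')]
  rw [setLIntegral_congr_fun (g := 0) measurableSet_Ici]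
  · simp only [Pi.zero_apply, lintegral_zero, add_zero]
    refine setLIntegral_congr_fun measurableSet_Ioo fun c hc => ?_
    simp only [ENNReal.ofReal_lt_iff_lt_toReal hc.1.le (hfin _)]
  · intro c hc
    simp only [Pi.zero_apply]
    convert measure_empty (μ := μ)
    ext x
    simp only [mem_ofPred_eq, mem_empty_iff_false, iff_false, not_lt]
    exact (ENNReal.toReal_mono ENNReal.one_ne_top (hf1 x)).trans (by simpa using hc)

/-- One-dimensional Prékopa-Leindler inequality for functions with supremum one. -/
lemma prekopa_leindler_real_of_sup_eq_one {p q : ℝ} (hp : 0 < p) (hq : 0 < q) (hpq : p + q = 1)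
    {f g h : ℝ → ℝ≥0∞} (hf : Measurable f) (hg : Measurable g) (hh : Measurable h)
    (hf1 : ⨆ x, f x = 1) (hg1 : ⨆ x, g x = 1)
    (H : ∀ x y, f x ^ p * g y ^ q ≤ h (p * x + q * y)) :
    ENNReal.ofReal p * (∫⁻ x, f x) + ENNReal.ofReal q * (∫⁻ x, g x) ≤ ∫⁻ x, h x := by
  have key : ENNReal.ofReal p * (∫⁻ x, f x) + ENNReal.ofReal q * (∫⁻ x, g x)
      ≤ ∫⁻ x, min (h x) 1 := by
    rw [lintegral_eq_lintegral_Ioo_measure_lt hf fun x => hf1 ▸ le_iSup f x,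
      lintegral_eq_lintegral_Ioo_measure_lt hg fun x => hg1 ▸ le_iSup g x,
      lintegral_eq_lintegral_Ioo_measure_lt (hh.min measurable_const) fun x => min_le_right _ _,
      ← lintegral_const_mul' _ _ ENNReal.ofReal_ne_top,
      ← lintegral_const_mul' _ _ ENNReal.ofReal_ne_top, ← lintegral_add_left']
    · refine setLIntegral_mono' measurableSet_Ioo fun c hc => ?_
      have hc1 : ENNReal.ofReal c < 1 := by simpa using hc.2
      have hne : ∀ {F : ℝ → ℝ≥0∞}, ⨆ x, F x = 1 → {x | ENNReal.ofReal c < F x}.Nonempty :=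
        fun hF => by
          obtain ⟨x, hx⟩ := lt_iSup_iff.1 (hF.symm ▸ hc1)
          exact ⟨x, hx⟩
      refine weighted_volume_add_le hp hq (measurableSet_lt measurable_const hf)
        (measurableSet_lt measurable_const hg) (hne hf1) (hne hg1) fun x hx y hy => lt_min ?_ hc1
      refine lt_of_lt_of_le ?_ (H x y)
      calc ENNReal.ofReal c = ENNReal.ofReal c ^ p * ENNReal.ofReal c ^ q := by
            rw [← ENNReal.rpow_add_of_nonneg _ _ hp.le hq.le, hpq, ENNReal.rpow_one]
        _ < _ := ENNReal.mul_lt_mul (ENNReal.rpow_lt_rpow hx hp) (ENNReal.rpow_lt_rpow hy hq)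
    · refine (Antitone.measurable fun a b hab => ?_).aemeasurable
      gcongr
  exact key.trans (lintegral_mono fun x => min_le_left _ _)

/-- One-dimensional Prékopa-Leindler inequality for bounded functions. -/
lemma prekopa_leindler_real_of_bounded {p q : ℝ} (hp : 0 < p) (hq : 0 < q) (hpq : p + q = 1)
    {f g h : ℝ → ℝ≥0∞} (hf : Measurable f) (hg : Measurable g) (hh : Measurable h)
    (hf1 : ⨆ x, f x ≠ ∞) (hg1 : ⨆ x, g x ≠ ∞)
    (H : ∀ x y, f x ^ p * g y ^ q ≤ h (p * x + q * y)) :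
    (∫⁻ x, f x) ^ p * (∫⁻ x, g x) ^ q ≤ ∫⁻ x, h x := by
  set a := ⨆ x, f x with ha
  set b := ⨆ x, g x with hb
  rcases eq_or_ne a 0 with ha0 | ha0
  · have : ∀ x, f x = 0 := by simpa [ha] using ha0
    simp [this, hp]
  rcases eq_or_ne b 0 with hb0 | hb0
  · have : ∀ x, g x = 0 := by simpa [hb] using hb0
    simp [this, hq]
  set c := (a ^ p)⁻¹ * (b ^ q)⁻¹ with hc
  have hap0 : a ^ p ≠ 0 := by simp [ha0, hf1]
  have hap : a ^ p ≠ ∞ := by simp [hf1, ha0]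
  have hbp0 : b ^ q ≠ 0 := by simp [hb0, hg1]
  have hbp : b ^ q ≠ ∞ := by simp [hg1, hb0]
  have hmul : ∀ u v : ℝ≥0∞, (a⁻¹ * u) ^ p * (b⁻¹ * v) ^ q = c * (u ^ p * v ^ q) := fun u v => by
    rw [ENNReal.mul_rpow_of_nonneg _ _ hp.le, ENNReal.mul_rpow_of_nonneg _ _ hq.le,
      ENNReal.inv_rpow, ENNReal.inv_rpow, hc]
    ring
  have h1 := prekopa_leindler_real_of_sup_eq_one hp hq hpq (hf.const_mul a⁻¹) (hg.const_mul b⁻¹)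
    (hh.const_mul c) (by rw [← ENNReal.mul_iSup, ← ha, ENNReal.inv_mul_cancel ha0 hf1])
    (by rw [← ENNReal.mul_iSup, ← hb, ENNReal.inv_mul_cancel hb0 hg1])
    (fun x y => by rw [hmul]; gcongr; exact H x y)
  have h2 := (ennreal_geom_mean_le_arith_mean hp hq hpq _ _).trans h1
  rw [lintegral_const_mul _ hf, lintegral_const_mul _ hg, lintegral_const_mul _ hh, hmul] at h2
  refine (ENNReal.mul_le_mul_iff_right (a := c) ?_ ?_).1 h2
  · simp [hc, hap, hbp]
  · simp [hc, hap0, hbp0, ENNReal.mul_eq_top]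

/-- One-dimensional Prékopa-Leindler inequality. -/
lemma prekopa_leindler_real {p q : ℝ} (hp : 0 < p) (hq : 0 < q) (hpq : p + q = 1)
    {f g h : ℝ → ℝ≥0∞} (hf : Measurable f) (hg : Measurable g) (hh : Measurable h)
    (H : ∀ x y, f x ^ p * g y ^ q ≤ h (p * x + q * y)) :
    (∫⁻ x, f x) ^ p * (∫⁻ x, g x) ^ q ≤ ∫⁻ x, h x := by
  have trunc : ∀ {f : ℝ → ℝ≥0∞}, Measurable f → ∀ {r : ℝ}, 0 < r →
      (∫⁻ x, f x) ^ r = ⨆ n : ℕ, (∫⁻ x, min (f x) n) ^ r := by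
    intro f hf r hr
    have h1 : ∀ x, f x = ⨆ n : ℕ, min (f x) n := fun x => by
      rw [← inf_iSup_eq, ENNReal.iSup_natCast, inf_top_eq]
    have h2 : ∫⁻ x, f x = ⨆ n : ℕ, ∫⁻ x, min (f x) n := by
      rw [← lintegral_iSup (fun n => hf.min measurable_const)
        (fun m n hmn x => by dsimp only; gcongr)]
      exact lintegral_congr h1
    rw [h2]
    exact (ENNReal.orderIsoRpow r hr).map_iSup _
  have hsup : ∀ (f : ℝ → ℝ≥0∞) (n : ℕ), ⨆ x, min (f x) n ≠ ∞ := fun f n =>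
    ne_top_of_le_ne_top (ENNReal.natCast_ne_top n) (iSup_le fun x => min_le_right _ _)
  rw [trunc hf hp, trunc hg hq, ENNReal.iSup_mul]
  refine iSup_le fun m => ?_
  rw [ENNReal.mul_iSup]
  refine iSup_le fun n => prekopa_leindler_real_of_bounded hp hq hpq
    (hf.min measurable_const) (hg.min measurable_const) hh (hsup f m) (hsup g n) fun x y => ?_
  refine le_trans ?_ (H x y)
  gcongr <;> exact min_le_left _ _

/-- Prékopa-Leindler inequality. -/
lemma prekopa_leindler {p q : ℝ} (hp : 0 < p) (hq : 0 < q) (hpq : p + q = 1) (n : ℕ)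
    {f g h : (Fin n → ℝ) → ℝ≥0∞} (hf : Measurable f) (hg : Measurable g) (hh : Measurable h)
    (H : ∀ x y, f x ^ p * g y ^ q ≤ h (p • x + q • y)) :
    (∫⁻ x, f x) ^ p * (∫⁻ x, g x) ^ q ≤ ∫⁻ x, h x := by
  induction n with
  | zero =>
    simp only [volume_pi, Measure.pi_of_empty (fun _ : Fin 0 => volume) 0, lintegral_dirac]
    simpa using H 0 0
  | succ n ih =>
    let e := MeasurableEquiv.piFinSuccAbove (fun _ : Fin (n + 1) => ℝ) 0
    have he : ∀ F : (Fin (n + 1) → ℝ) → ℝ≥0∞, Measurable F →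
        ∫⁻ x, F x = ∫⁻ s : ℝ, ∫⁻ y : Fin n → ℝ, F (e.symm (s, y)) := fun F hF => by
      rw [← ((volume_preserving_piFinSuccAbove (fun _ : Fin (n + 1) => ℝ) 0).symm).lintegral_comp
        hF]
      exact lintegral_prod _ (hF.comp e.symm.measurable).aemeasurable
    have hm : ∀ F : (Fin (n + 1) → ℝ) → ℝ≥0∞, Measurable F →
        Measurable fun z : ℝ × (Fin n → ℝ) => F (e.symm z) := fun F hF => hF.comp e.symm.measurable
    rw [he f hf, he g hg, he h hh]
    refine prekopa_leindler_real hp hq hpq (hm f hf).lintegral_prod_right'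
      (hm g hg).lintegral_prod_right' (hm h hh).lintegral_prod_right' fun s t => ?_
    refine ih ((hm f hf).comp measurable_prodMk_left) ((hm g hg).comp measurable_prodMk_left)
      ((hm h hh).comp measurable_prodMk_left) fun x y => ?_
    convert H (e.symm (s, x)) (e.symm (t, y)) using 2
    ext i
    refine Fin.cases ?_ (fun j => ?_) i <;>
      simp [e, MeasurableEquiv.piFinSuccAbove, Fin.insertNthEquiv]

/-- A log-concave function agrees almost everywhere with a measurable log-concave function. -/
lemma IsLogConcaveFun.exists_measurable {d : ℕ} {h : EucSp d → ℝ} (hh : IsLogConcaveFun h) :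
    ∃ g : EucSp d → ℝ, IsLogConcaveFun g ∧ Measurable g ∧ h =ᵐ[volume] g := by
  classical
  obtain ⟨h0, hlc⟩ := hh
  let K : Set (EucSp d) := {x | 0 < h x}
  have hK : Convex ℝ K := by
    intro x hx y hy a b ha hb hab
    have := hlc x y a ⟨ha, by linarith⟩
    rw [show 1 - a = b by linarith] at this
    exact (mul_pos (rpow_pos_of_pos hx _) (rpow_pos_of_pos hy _)).trans_le this
  have hlog : ConcaveOn ℝ K fun x => log (h x) := by
    refine ⟨hK, fun x hx y hy a b ha hb hab => ?_⟩
    have := hlc x y a ⟨ha, by linarith⟩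
    rw [show 1 - a = b by linarith] at this
    have h2 := log_le_log (mul_pos (rpow_pos_of_pos hx _) (rpow_pos_of_pos hy _)) this
    rwa [log_mul (rpow_pos_of_pos hx _).ne' (rpow_pos_of_pos hy _).ne', log_rpow hx,
      log_rpow hy] at h2
  have hcont : ContinuousOn h (interior K) :=
    (hlog.continuousOn_interior.rexp).congr fun x hx =>
      (exp_log (show x ∈ K from interior_subset hx)).symm
  refine ⟨(interior K).indicator h, ⟨fun x => indicator_nonneg (fun x _ => h0 x) x, ?_⟩, ?_, ?_⟩
  · intro x y t ht
    rcases eq_or_lt_of_le ht.1 with rfl | ht0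
    · simp
    rcases eq_or_lt_of_le ht.2 with rfl | ht1
    · simp
    by_cases hx : x ∈ interior K
    swap
    · simp only [indicator_of_notMem hx, zero_rpow ht0.ne', zero_mul]
      exact indicator_nonneg (fun x _ => h0 x) _
    by_cases hy : y ∈ interior K
    swap
    · simp only [indicator_of_notMem hy, zero_rpow (sub_pos.2 ht1).ne', mul_zero]
      exact indicator_nonneg (fun x _ => h0 x) _
    rw [indicator_of_mem hx, indicator_of_mem hy, indicator_of_mem]
    · exact hlc x y t ht
    · exact hK.interior hx hy ht.1 (by linarith) (by linarith)
  · rw [← piecewise_eq_indicator]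
    exact hcont.measurable_piecewise continuousOn_const isOpen_interior.measurableSet
  · have : ∀ᵐ x ∂volume, x ∉ frontier K := by
      simpa [ae_iff] using hK.addHaar_frontier volume
    filter_upwards [this] with x hx
    by_cases hxi : x ∈ interior K
    · rw [indicator_of_mem hxi]
    · rw [indicator_of_notMem hxi]
      by_contra hne
      exact hx ⟨subset_closure (lt_of_le_of_ne (h0 x) (Ne.symm hne)), hxi⟩

/-- A log-concave measure is log-concave on half-spaces with a common normal vector. -/
lemma IsLogConcaveMeasure.measure_halfSpace {d : ℕ} {μ : Measure (EucSp d)}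
    (hμ : IsLogConcaveMeasure μ) (v : EucSp d) {p q : ℝ} (hp : 0 < p) (hq : 0 < q)
    (hpq : p + q = 1) (s t : ℝ) :
    μ {x | s < ⟪v, x⟫} ^ p * μ {x | t < ⟪v, x⟫} ^ q ≤ μ {x | p * s + q * t < ⟪v, x⟫} := by
  obtain ⟨h, hh, rfl⟩ := hμ
  obtain ⟨g, ⟨g0, hg⟩, hgm, hhg⟩ := hh.exists_measurable
  rw [withDensity_congr_ae (g := fun x => ENNReal.ofReal (g x))
    (hhg.mono fun x hx => by simp only [hx])]
  have hm : ∀ r, MeasurableSet {x : EucSp d | r < ⟪v, x⟫} := fun r =>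
    measurableSet_lt measurable_const (by fun_prop)
  let F : ℝ → EucSp d → ℝ≥0∞ := fun r =>
    {x : EucSp d | r < ⟪v, x⟫}.indicator fun x => ENNReal.ofReal (g x)
  have hFm : ∀ r, Measurable (F r) := fun r => hgm.ennreal_ofReal.indicator (hm r)
  have hF : ∀ r, (volume.withDensity fun x => ENNReal.ofReal (g x)) {x : EucSp d | r < ⟪v, x⟫} =
      ∫⁻ x : Fin d → ℝ, F r (WithLp.toLp 2 x) := fun r => by
    rw [(PiLp.volume_preserving_toLp (Fin d)).lintegral_comp (hFm r), withDensity_apply _ (hm r),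
      lintegral_indicator (hm r)]
  have hLp : Measurable (WithLp.toLp 2 : (Fin d → ℝ) → EucSp d) :=
    (PiLp.volume_preserving_toLp (Fin d)).measurable
  rw [hF, hF, hF]
  refine prekopa_leindler hp hq hpq d ((hFm s).comp hLp) ((hFm t).comp hLp) ((hFm _).comp hLp)
    fun x y => ?_
  rw [WithLp.toLp_add, WithLp.toLp_smul, WithLp.toLp_smul]
  generalize (WithLp.toLp 2 x : EucSp d) = x
  generalize (WithLp.toLp 2 y : EucSp d) = y
  by_cases hx : s < ⟪v, x⟫
  swap
  · simp [F, hx, hp]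
  by_cases hy : t < ⟪v, y⟫
  swap
  · simp [F, hy, hq]
  have hxy : p * s + q * t < ⟪v, p • x + q • y⟫ := by
    rw [inner_add_right, real_inner_smul_right, real_inner_smul_right]
    gcongr
  have := hg x y p ⟨hp.le, by linarith⟩
  rw [show 1 - p = q by linarith] at this
  simp only [F, indicator_of_mem (show x ∈ {x | s < ⟪v, x⟫} from hx),
    indicator_of_mem (show y ∈ {x | t < ⟪v, x⟫} from hy),
    indicator_of_mem (show p • x + q • y ∈ {x | p * s + q * t < ⟪v, x⟫} from hxy)]
  rw [ENNReal.ofReal_rpow_of_nonneg (g0 _) hp.le, ENNReal.ofReal_rpow_of_nonneg (g0 _) hq.le,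
    ← ENNReal.ofReal_mul (rpow_nonneg (g0 _) _)]
  exact ENNReal.ofReal_le_ofReal this

/-- The survival function of the real random variable `Y` is log-concave. -/
def HasLogConcaveSurvival {Ω : Type*} [MeasurableSpace Ω] (μ : Measure Ω) (Y : Ω → ℝ) : Prop :=
  ∀ p q : ℝ, 0 < p → 0 < q → p + q = 1 → ∀ s t : ℝ,
    μ {ω | s < Y ω} ^ p * μ {ω | t < Y ω} ^ q ≤ μ {ω | p * s + q * t < Y ω}

section Tail

variable {Ω : Type*} [MeasurableSpace Ω] {μ : Measure Ω} [IsProbabilityMeasure μ] {Y : Ω → ℝ}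

/-- Exponential tail decay under a log-concave survival function and unit second moment. -/
lemma HasLogConcaveSurvival.measure_lt_le (hY : HasLogConcaveSurvival μ Y) (hm : Measurable Y)
    (hi : Integrable (fun ω => Y ω ^ 2) μ) (h2 : ∫ ω, Y ω ^ 2 ∂μ = 1) {t : ℝ} (ht : 3 < t) :
    μ {ω | t < Y ω} ≤ ENNReal.ofReal (2 ^ (-(t + 3) / 2)) := by
  set A := μ.real {ω | 3 < Y ω} with hA
  set B := μ.real {ω | -3 < Y ω} with hB
  set T := μ.real {ω | t < Y ω} with hT
  have hm3 : MeasurableSet {ω | -3 < Y ω} := measurableSet_lt measurable_const hm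
  have hcheb : μ.real {ω | 9 ≤ Y ω ^ 2} ≤ 1 / 9 := by
    have := mul_meas_ge_le_integral_of_nonneg (Eventually.of_forall fun ω => sq_nonneg (Y ω)) hi 9
    rw [h2] at this
    linarith
  have hAB : A + (1 - B) ≤ 1 / 9 := by
    rw [hB, ← probReal_compl_eq_one_sub hm3, hA, ← measureReal_union _ hm3.compl]
    · refine (measureReal_mono ?_).trans hcheb
      rintro ω (hω | hω)
      · have : 3 < Y ω := hω
        show 9 ≤ Y ω ^ 2
        nlinarith
      · have : Y ω ≤ -3 := not_lt.1 hω
        show 9 ≤ Y ω ^ 2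
        nlinarith
    · refine Set.disjoint_left.2 fun ω (h1 : 3 < Y ω) h2 => h2 ?_
      show -3 < Y ω
      linarith
  have hA0 : 0 ≤ A := measureReal_nonneg
  have hT0 : 0 ≤ T := measureReal_nonneg
  have hB1 : B ≤ 1 := measureReal_le_one
  have hB0 : 0 < B := by linarith
  have ht3 : 0 < t + 3 := by linarith
  set r := 6 / (t + 3) with hr
  have hr0 : 0 < r := by positivity
  have hr1 : r < 1 := by rw [hr, div_lt_one ht3]; linarith
  have hlc : B ^ (1 - r) * T ^ r ≤ A := by
    have h := hY (1 - r) r (by linarith) hr0 (by ring) (-3) t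
    have h3 : (1 - r) * (-3) + r * t = 3 := by rw [hr]; field_simp; ring
    rw [h3] at h
    have h' := ENNReal.toReal_mono (measure_ne_top _ _) h
    rwa [ENNReal.toReal_mul, ← ENNReal.toReal_rpow, ← ENNReal.toReal_rpow] at h'
  have hBr : B ≤ B ^ (1 - r) := by
    conv_lhs => rw [← rpow_one B]
    exact rpow_le_rpow_of_exponent_ge hB0 hB1 (by linarith)
  have hTr : T ^ r ≤ 1 / 8 := by
    have h1 : B * T ^ r ≤ A := le_trans (by gcongr) hlc
    have h2 : B * T ^ r ≤ B * (1 / 8) := by linarith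
    exact le_of_mul_le_mul_left h2 hB0
  have hTle : T ≤ 2 ^ (-(t + 3) / 2) := by
    have h1 := rpow_le_rpow (rpow_nonneg hT0 r) hTr (inv_nonneg.2 hr0.le)
    rw [rpow_rpow_inv hT0 hr0.ne'] at h1
    refine h1.trans_eq ?_
    rw [show (1 / 8 : ℝ) = 2 ^ (-3 : ℝ) by rw [rpow_neg (by norm_num)]; norm_num,
      ← rpow_mul (by norm_num), hr, inv_div]
    congr 1
    ring
  rw [← ENNReal.ofReal_toReal (measure_ne_top μ {ω | t < Y ω})]
  exact ENNReal.ofReal_le_ofReal hTle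

lemma HasLogConcaveSurvival.lintegral_two_rpow_le (hY : HasLogConcaveSurvival μ Y)
    (hY' : HasLogConcaveSurvival μ fun ω => -Y ω) (hm : Measurable Y)
    (hi : Integrable (fun ω => Y ω ^ 2) μ) (h2 : ∫ ω, Y ω ^ 2 ∂μ = 1) :
    ∫⁻ ω, ENNReal.ofReal (2 ^ (3 / 8 * |Y ω|)) ∂μ ≤ ENNReal.ofReal (7 / 2 * 2 ^ (1 / 8 : ℝ)) := by
  have two_pos : (0 : ℝ) < 2 := by norm_num
  set w₀ : ℝ := 2 ^ (9 / 8 : ℝ) with hw₀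
  have hw₀pos : 0 < w₀ := rpow_pos_of_pos two_pos _
  rw [lintegral_eq_lintegral_meas_lt μ (Eventually.of_forall fun ω => (rpow_pos_of_pos two_pos _).le)
    (by fun_prop), ← Ioc_union_Ioi_eq_Ioi hw₀pos.le, lintegral_union measurableSet_Ioi
      (Set.disjoint_left.2 fun x hx hx' => (not_lt.2 hx.2) hx')]
  have hI : IntegrableOn (fun w : ℝ => 2 ^ (-1 / 2 : ℝ) * w ^ (-4 / 3 : ℝ)) (Ioi w₀) :=
    (integrableOn_Ioi_rpow_of_lt (by norm_num) hw₀pos).const_mul _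
  have hfirst : ∫⁻ w in Ioc 0 w₀, μ {ω | w < 2 ^ (3 / 8 * |Y ω|)} ≤ ENNReal.ofReal w₀ := by
    refine (lintegral_mono (g := fun _ => 1) fun w => prob_le_one).trans_eq ?_
    simp
  have hsecond : ∫⁻ w in Ioi w₀, μ {ω | w < 2 ^ (3 / 8 * |Y ω|)} ≤
      ENNReal.ofReal (3 / 2 * 2 ^ (1 / 8 : ℝ)) := by
    have hint : ∫ w in Ioi w₀, 2 ^ (-1 / 2 : ℝ) * w ^ (-4 / 3 : ℝ) = 3 / 2 * 2 ^ (1 / 8 : ℝ) := by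
      rw [integral_const_mul, integral_Ioi_rpow_of_lt (by norm_num) hw₀pos, hw₀,
        ← rpow_mul two_pos.le]
      have : (2 : ℝ) ^ (-1 / 2 : ℝ) * 2 ^ (9 / 8 * (-4 / 3 + 1) : ℝ) = 1 / 2 * 2 ^ (1 / 8 : ℝ) := by
        rw [← rpow_add two_pos, show (1 / 2 : ℝ) = 2 ^ (-1 : ℝ) by rw [rpow_neg_one]; norm_num,
          ← rpow_add two_pos]
        norm_num
      linear_combination 3 * this
    rw [← hint, ofReal_integral_eq_lintegral_ofReal hI (by
      filter_upwards [ae_restrict_mem measurableSet_Ioi] with w hw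
      have : 0 < w := hw₀pos.trans hw
      simp only [Pi.zero_apply]
      positivity)]
    refine setLIntegral_mono' measurableSet_Ioi fun w hw => ?_
    have hw0 : 0 < w := hw₀pos.trans hw
    set t := 8 / 3 * logb 2 w with ht
    have hwt : w = 2 ^ (3 / 8 * t) := by
      rw [ht, ← mul_assoc, show (3 / 8 * (8 / 3) : ℝ) = 1 by norm_num, one_mul,
        rpow_logb two_pos (by norm_num) hw0]
    have ht3 : 3 < t := by
      have : w₀ < w := hw
      rw [hw₀, hwt, rpow_lt_rpow_left_iff (by norm_num)] at this
      linarith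
    have hsub : {ω | w < 2 ^ (3 / 8 * |Y ω|)} ⊆ {ω | t < Y ω} ∪ {ω | t < -Y ω} := by
      intro ω (hω : w < 2 ^ (3 / 8 * |Y ω|))
      rw [hwt, rpow_lt_rpow_left_iff (by norm_num)] at hω
      have : t < |Y ω| := by linarith
      exact lt_abs.1 this
    calc μ {ω | w < 2 ^ (3 / 8 * |Y ω|)} ≤ μ {ω | t < Y ω} + μ {ω | t < -Y ω} :=
          (measure_mono hsub).trans (measure_union_le _ _)
      _ ≤ ENNReal.ofReal (2 ^ (-(t + 3) / 2)) + ENNReal.ofReal (2 ^ (-(t + 3) / 2)) :=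
          add_le_add (hY.measure_lt_le hm hi h2 ht3)
            (hY'.measure_lt_le hm.neg (by simpa using hi) (by simpa using h2) ht3)
      _ = ENNReal.ofReal (2 ^ (-1 / 2 : ℝ) * w ^ (-4 / 3 : ℝ)) := by
          rw [← ENNReal.ofReal_add (by positivity) (by positivity), ← two_mul]
          congr 1
          rw [hwt, ← rpow_mul two_pos.le, ← rpow_add two_pos]
          nth_rewrite 1 [← rpow_one 2]
          rw [← rpow_add two_pos]
          congr 1
          ring
  refine (add_le_add hfirst hsecond).trans_eq ?_
  rw [← ENNReal.ofReal_add hw₀pos.le (by positivity), hw₀,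
    show (9 / 8 : ℝ) = 1 + 1 / 8 by norm_num, rpow_add two_pos, rpow_one]
  congr 1
  ring

lemma rpow_le_mul_two_rpow {k x : ℝ} (hk : 0 < k) (hx : 0 ≤ x) :
    x ^ k ≤ (71 / 50 * k) ^ k * 2 ^ (3 / 8 * x) := by
  have hc : 1 ≤ 71 / 50 * (3 / 8 * log 2) * exp 1 := by
    have h1 := Real.log_two_gt_d9
    have h2 := Real.exp_one_gt_d9
    nlinarith
  set u := 3 / 8 * log 2 * x / k with hu
  have hlog : 0 < log 2 := log_pos (by norm_num)
  have h1 : u * exp 1 ≤ exp u := by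
    have h := add_one_le_exp (u - 1)
    rw [sub_add_cancel, exp_sub, le_div_iff₀ (exp_pos 1)] at h
    exact h
  have h2 : x ≤ 71 / 50 * k * exp u := by
    calc x = 1 * x := (one_mul x).symm
      _ ≤ 71 / 50 * (3 / 8 * log 2) * exp 1 * x := by gcongr
      _ = 71 / 50 * k * (u * exp 1) := by rw [hu]; field_simp
      _ ≤ _ := by gcongr
  calc x ^ k ≤ (71 / 50 * k * exp u) ^ k := rpow_le_rpow hx h2 hk.le
    _ = (71 / 50 * k) ^ k * 2 ^ (3 / 8 * x) := by
      rw [mul_rpow (by positivity) (exp_pos u).le, ← exp_mul,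
        rpow_def_of_pos (by norm_num) (3 / 8 * x)]
      congr 2
      rw [hu]
      field_simp

lemma HasLogConcaveSurvival.moment_le_of_four_le (hY : HasLogConcaveSurvival μ Y)
    (hY' : HasLogConcaveSurvival μ fun ω => -Y ω) (hm : Measurable Y)
    (hi : Integrable (fun ω => Y ω ^ 2) μ) (h2 : ∫ ω, Y ω ^ 2 ∂μ = 1) {k : ℝ} (hk : 4 ≤ k) :
    Integrable (fun ω => |Y ω| ^ k) μ ∧ ∫ ω, |Y ω| ^ k ∂μ ≤ (2 * k) ^ k := by
  have hk0 : 0 < k := by linarith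
  have hle := hY.lintegral_two_rpow_le hY' hm hi h2
  have hWi : Integrable (fun ω => (2 : ℝ) ^ (3 / 8 * |Y ω|)) μ :=
    ⟨Measurable.aestronglyMeasurable (by fun_prop),
      (hasFiniteIntegral_iff_ofReal (Eventually.of_forall fun ω => by
        simp only [Pi.zero_apply]; positivity)).2 (hle.trans_lt ENNReal.ofReal_lt_top)⟩
  have hW : ∫ ω, (2 : ℝ) ^ (3 / 8 * |Y ω|) ∂μ ≤ 7 / 2 * 2 ^ (1 / 8 : ℝ) := by
    rw [← ofReal_integral_eq_lintegral_ofReal hWi (Eventually.of_forall fun ω => by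
      simp only [Pi.zero_apply]; positivity)] at hle
    exact (ENNReal.ofReal_le_ofReal_iff (by positivity)).1 hle
  have hroot : (2 : ℝ) ^ (1 / 8 : ℝ) ≤ 11 / 10 := by
    have h := rpow_le_rpow (by norm_num) (show (2 : ℝ) ≤ (11 / 10) ^ (8 : ℝ) by norm_num)
      (show (0 : ℝ) ≤ 1 / 8 by norm_num)
    rwa [← rpow_mul (by norm_num), show (8 : ℝ) * (1 / 8) = 1 by norm_num, rpow_one] at h
  have hpt : ∀ ω, |Y ω| ^ k ≤ (71 / 50 * k) ^ k * 2 ^ (3 / 8 * |Y ω|) := fun ω =>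
    rpow_le_mul_two_rpow hk0 (abs_nonneg _)
  have hdom := hWi.const_mul ((71 / 50 * k) ^ k)
  refine ⟨hdom.mono' (hm.abs.pow_const k).aestronglyMeasurable
    (Eventually.of_forall fun ω => ?_), ?_⟩
  · rw [norm_of_nonneg (by positivity)]
    exact hpt ω
  · have hsmall : (71 / 100 : ℝ) ^ k ≤ (71 / 100) ^ (4 : ℝ) :=
      rpow_le_rpow_of_exponent_ge (by norm_num) (by norm_num) hk
    calc ∫ ω, |Y ω| ^ k ∂μ ≤ ∫ ω, (71 / 50 * k) ^ k * 2 ^ (3 / 8 * |Y ω|) ∂μ :=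
          integral_mono_of_nonneg (Eventually.of_forall fun ω => by
            simp only [Pi.zero_apply]; positivity) hdom (Eventually.of_forall hpt)
      _ ≤ (71 / 50 * k) ^ k * (7 / 2 * (11 / 10)) := by
          rw [integral_const_mul]
          gcongr
          exact hW.trans (by gcongr)
      _ = (2 * k) ^ k * ((71 / 100) ^ k * (7 / 2 * (11 / 10))) := by
          rw [show 71 / 50 * k = 2 * k * (71 / 100) by ring,
            mul_rpow (by positivity) (by norm_num), mul_assoc]
      _ ≤ (2 * k) ^ k * ((71 / 100) ^ (4 : ℝ) * (7 / 2 * (11 / 10))) := by gcongr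
      _ ≤ (2 * k) ^ k * 1 := by gcongr; norm_num
      _ = _ := mul_one _

lemma rpow_sixtyFour_le {k : ℝ} (hk : 2 ≤ k) (hk4 : k ≤ 4) :
    (4096 : ℝ) ^ ((k - 2) / 2) ≤ (2 * k) ^ k := by
  have hk0 : 0 < k := by linarith
  rw [← log_le_log_iff (by positivity) (by positivity), log_rpow (by norm_num),
    log_rpow (by positivity), show (4096 : ℝ) = 2 ^ 12 by norm_num, log_pow]
  have h1 : 1 - (k / 4)⁻¹ ≤ log (k / 4) := one_sub_inv_le_log_of_pos (by positivity)
  have h2 : log (2 * k) = 3 * log 2 + log (k / 4) := by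
    rw [show 2 * k = 2 ^ 3 * (k / 4) by ring, log_mul (by norm_num) (by positivity), log_pow]
    norm_num
  have h3 : k - 4 ≤ k * log (k / 4) := by
    calc k - 4 = k * (1 - (k / 4)⁻¹) := by field_simp
      _ ≤ _ := by gcongr
  rw [h2]
  have h4 := Real.log_two_gt_d9
  push_cast
  nlinarith

/-- Absolute moments of a random variable with unit second moment whose two tails are both
log-concave. -/
lemma HasLogConcaveSurvival.moment_le (hY : HasLogConcaveSurvival μ Y)
    (hY' : HasLogConcaveSurvival μ fun ω => -Y ω) (hm : Measurable Y)
    (hi : Integrable (fun ω => Y ω ^ 2) μ) (h2 : ∫ ω, Y ω ^ 2 ∂μ = 1) {k : ℝ} (hk : 1 ≤ k) :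
    ∫ ω, |Y ω| ^ k ∂μ ≤ (2 * k) ^ k := by
  have hnn : 0 ≤ᵐ[μ] fun ω => |Y ω| ^ k := Eventually.of_forall fun ω => by
    simp only [Pi.zero_apply]; positivity
  rcases le_total 4 k with hk4 | hk4
  · exact (hY.moment_le_of_four_le hY' hm hi h2 hk4).2
  rcases le_total 2 k with hk2 | hk2
  · obtain ⟨hi4, hM4⟩ := hY.moment_le_of_four_le hY' hm hi h2 le_rfl
    have habs : ∀ ω, |Y ω| ^ (4 : ℝ) = (Y ω ^ 2) ^ 2 := fun ω => by
      rw [show (4 : ℝ) = ((4 : ℕ) : ℝ) by norm_num, rpow_natCast, ← sq_abs (Y ω)]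
      ring
    simp only [habs] at hi4 hM4
    norm_num at hM4
    set r := (k - 2) / 2 with hr
    have hr0 : 0 ≤ r := by rw [hr]; linarith
    have hr1 : 0 ≤ 1 - r := by rw [hr]; linarith
    have hpt : ∀ ω, |Y ω| ^ k ≤
        4096 ^ r * ((1 - r) * Y ω ^ 2 + r / 4096 * (Y ω ^ 2) ^ 2) := fun ω => by
      have h := Real.geom_mean_le_arith_mean2_weighted hr1 hr0 zero_le_one
        (show 0 ≤ Y ω ^ 2 / 4096 by positivity) (by ring)
      rw [one_rpow, one_mul, div_rpow (sq_nonneg _) (by norm_num),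
        div_le_iff₀ (by positivity)] at h
      calc |Y ω| ^ k = Y ω ^ 2 * (Y ω ^ 2) ^ r := by
            rw [← sq_abs, ← rpow_natCast, ← rpow_mul (abs_nonneg _),
              ← rpow_add_of_nonneg (abs_nonneg _) (by norm_num) (by positivity)]
            congr 1
            rw [hr]
            push_cast
            ring
        _ ≤ Y ω ^ 2 * (((1 - r) * 1 + r * (Y ω ^ 2 / 4096)) * 4096 ^ r) := by gcongr
        _ = _ := by ring
    have hdom := ((hi.const_mul (1 - r)).add (hi4.const_mul (r / 4096))).const_mul (4096 ^ r)
    refine (integral_mono_of_nonneg hnn hdom (Eventually.of_forall hpt)).trans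
      (le_trans ?_ (rpow_sixtyFour_le hk2 hk4))
    rw [integral_const_mul]
    simp only [Pi.add_apply]
    rw [integral_add (hi.const_mul _) (hi4.const_mul _),
      integral_const_mul, integral_const_mul, h2]
    refine mul_le_of_le_one_right (by positivity) ?_
    nlinarith
  · have hpt : ∀ ω, |Y ω| ^ k ≤ 1 + Y ω ^ 2 := fun ω => by
      rcases le_total |Y ω| 1 with h | h
      · exact (rpow_le_one (abs_nonneg _) h (by linarith)).trans (by nlinarith [sq_nonneg (Y ω)])
      · refine (rpow_le_rpow_of_exponent_le h hk2).trans ?_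
        rw [rpow_two, sq_abs]
        linarith
    refine (integral_mono_of_nonneg hnn ((integrable_const 1).add hi)
      (Eventually.of_forall hpt)).trans ?_
    simp only [Pi.add_apply]
    rw [integral_add (integrable_const 1) hi, h2, integral_const]
    calc μ.real univ • (1 : ℝ) + 1 = 2 := by simp; norm_num
      _ ≤ 2 * k := by linarith
      _ ≤ (2 * k) ^ k := self_le_rpow_of_one_le (by linarith) hk

end Tail

/-- **Theorem (Statement 13).** k-th moment bound for perturbed standardization: let `U`
have a log-concave distribution `μ` on `ℝ^d`, let `H` be the symmetric square root of its
covariance matrix (invertible, with inverse `Hinv`), and let `J` be invertible (with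
inverse `Jinv`) with `‖I − H⁻¹J‖ < 1/2`.  Then with `V = J⁻¹(U − E[U])`, for every
`k ≥ 1`, `sup_{‖a‖=1} E[|⟨a, V⟩|^k] ≤ 2^{2k}·k^k`. -/
theorem perturbed_standardization_moment_bound {d : ℕ}
    (μ : Measure (EucSp d)) [IsProbabilityMeasure μ]
    (hlc : IsLogConcaveMeasure μ)
    (hint : Integrable (fun x => x) μ)
    (H Hinv J Jinv : EucSp d →L[ℝ] EucSp d)
    (hHsymm : ∀ x y : EucSp d, ⟪H x, y⟫ = ⟪x, H y⟫)
    (hHsq : ∀ a b : EucSp d,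
      ⟪a, H (H b)⟫ = ∫ x, ⟪a, x - ∫ y, y ∂μ⟫ * ⟪b, x - ∫ y, y ∂μ⟫ ∂μ)
    (hHinv : ∀ x : EucSp d, H (Hinv x) = x ∧ Hinv (H x) = x)
    (hJinv : ∀ x : EucSp d, J (Jinv x) = x ∧ Jinv (J x) = x)
    (hnear : ‖ContinuousLinearMap.id ℝ (EucSp d) - Hinv.comp J‖ < 1 / 2)
    (k : ℝ) (hk : 1 ≤ k) :
    ∀ a : EucSp d, ‖a‖ = 1 →
      ∫ x, |⟪a, Jinv (x - ∫ y, y ∂μ)⟫| ^ k ∂μ ≤ 2 ^ (2 * k) * k ^ k := by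
  intro a ha
  set m := ∫ y, y ∂μ with hm
  set c : EucSp d := ContinuousLinearMap.adjoint Jinv a with hc
  have hca : ∀ v, ⟪a, Jinv v⟫ = ⟪c, v⟫ := fun v =>
    (ContinuousLinearMap.adjoint_inner_left Jinv v a).symm
  simp only [hca]
  set σ := ‖H c‖ with hσ
  have hσsq : ⟪c, H (H c)⟫ = σ ^ 2 := by rw [← hHsymm, real_inner_self_eq_norm_sq]
  have hbound : ∀ v, ‖Jinv (H v)‖ ≤ 2 * ‖v‖ := fun v => by
    have h1 := (ContinuousLinearMap.id ℝ (EucSp d) - Hinv.comp J).le_of_opNorm_le hnear.le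
      (Jinv (H v))
    simp only [sub_apply, ContinuousLinearMap.id_apply,
      ContinuousLinearMap.comp_apply, (hJinv _).1, (hHinv _).2] at h1
    have h2 := norm_le_norm_sub_add (Jinv (H v)) v
    linarith
  have hσ2 : σ ≤ 2 := by
    by_contra! hlt
    have h1 : σ ^ 2 ≤ 1 * (2 * σ) := by
      rw [← hσsq, ← hca, ← ha]
      exact (real_inner_le_norm _ _).trans (by gcongr; exact hbound _)
    nlinarith
  have hσ0 : 0 < σ := by
    refine (norm_nonneg _).lt_of_ne' fun h0 => ?_
    have hc0 : c = 0 := by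
      rw [← (hHinv c).2, norm_eq_zero.1 h0, map_zero]
    have hcc := hca (J a)
    rw [(hJinv a).2, hc0, inner_zero_left, real_inner_self_eq_norm_sq, ha] at hcc
    norm_num at hcc
  have hX2 : ∫ x, ⟪c, x - m⟫ ^ 2 ∂μ = σ ^ 2 := by
    rw [← hσsq, hHsq]
    simp only [sq]
  have hXi : Integrable (fun x => ⟪c, x - m⟫ ^ 2) μ := by
    by_contra hni
    rw [integral_undef hni] at hX2
    exact (pow_pos hσ0 2).ne hX2
  let Y : EucSp d → ℝ := fun x => ⟪c, x - m⟫ / σ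
  have hYm : Measurable Y := by fun_prop
  have hY2 : (fun x => Y x ^ 2) = fun x => ⟪c, x - m⟫ ^ 2 / σ ^ 2 := by
    ext x
    exact div_pow _ _ _
  have hsurv : ∀ v : EucSp d, ∀ β : ℝ, HasLogConcaveSurvival μ fun x => ⟪v, x⟫ - β := by
    intro v β p q hp hq hpq s t
    have h := hlc.measure_halfSpace v hp hq hpq (s + β) (t + β)
    rw [show p * (s + β) + q * (t + β) = p * s + q * t + β by linear_combination β * hpq] at h
    simpa only [lt_sub_iff_add_lt] using h
  have hYs : HasLogConcaveSurvival μ Y := by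
    convert hsurv (σ⁻¹ • c) ⟪σ⁻¹ • c, m⟫ using 2 with x
    simp only [Y, inner_sub_right, real_inner_smul_left]
    ring
  have hYs' : HasLogConcaveSurvival μ fun x => -Y x := by
    convert hsurv (-(σ⁻¹ • c)) ⟪-(σ⁻¹ • c), m⟫ using 2 with x
    simp only [Y, inner_sub_right, real_inner_smul_left, inner_neg_left]
    ring
  have hmom := hYs.moment_le hYs' hYm (by rw [hY2]; exact hXi.div_const _)
    (by rw [hY2, integral_div, hX2, div_self (pow_pos hσ0 2).ne']) hk
  have hXY : ∀ x, |⟪c, x - m⟫| ^ k = σ ^ k * |Y x| ^ k := fun x => by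
    rw [← mul_rpow hσ0.le (abs_nonneg _)]
    simp only [Y, abs_div, abs_of_pos hσ0]
    rw [mul_div_cancel₀ _ hσ0.ne']
  simp only [hXY]
  rw [integral_const_mul]
  calc σ ^ k * ∫ x, |Y x| ^ k ∂μ ≤ 2 ^ k * (2 * k) ^ k := by gcongr
    _ = 2 ^ (2 * k) * k ^ k := by
      rw [mul_rpow (by norm_num) (by linarith), ← mul_assoc, ← rpow_add (by norm_num), two_mul]
end
end
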